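/- arXiv:0807.4302 — 3 statements merged into one kernel-verified Lean document; each statement's English description precedes it below -/
import Mathlib

section
/- Let f = z·x² + w·y³ and g = x in ℚ[x,y,z,w]. For every b ∈ ℚ[s], b satisfies the Bernstein–Sato functional equation for the pair (f, g) if and only if (s + 1)(s + 4/3)(s + 5/3)(s + 11/6)(s + 2)(s + 13/6)(s + 5/2) divides b in ℚ[s]; that is, b_{f,x}(s) = (s + 1)(s + 4/3)(s + 5/3)(s + 11/6)(s + 2)(s + 13/6)(s + 5/2). -/
open MvPolynomial Polynomial

/-- The iterated formal partial derivative `∂^α = ∏ᵢ ∂_{xᵢ}^{αᵢ}` applied to a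
multivariate polynomial (the partial derivatives pairwise commute, so the order
of the fold is immaterial). -/
noncomputable def pdIter {σ : Type*} [Fintype σ] (α : σ → ℕ)
    (p : MvPolynomial σ ℚ) : MvPolynomial σ ℚ :=
  Finset.univ.toList.foldl (fun q i => (⇑(MvPolynomial.pderiv i))^[α i] q) p

/-- `b ∈ ℚ[s]` satisfies the Bernstein–Sato functional equation for the pair
`(f, g)`: there are finitely many multi-indices `α` and polynomials
`p_α ∈ (ℚ[x])[s]` with `b(m)·g·f^m = Σ_α p_α(m)·∂^α(g·f^(m+1))` for all `m ∈ ℕ`. -/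
def SatisfiesBS {σ : Type*} [Fintype σ] (f g : MvPolynomial σ ℚ)
    (b : Polynomial ℚ) : Prop :=
  ∃ (A : Finset (σ → ℕ)) (p : (σ → ℕ) → Polynomial (MvPolynomial σ ℚ)),
    ∀ m : ℕ,
      MvPolynomial.C (Polynomial.eval (m : ℚ) b) * g * f ^ m =
        ∑ α ∈ A, Polynomial.eval ((m : ℕ) : MvPolynomial σ ℚ) (p α) *
          pdIter α (g * f ^ (m + 1))


section PdIter

variable {σ : Type*}

theorem pderiv_pderiv_comm (i j : σ) (p : MvPolynomial σ ℚ) :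
    pderiv i (pderiv j p) = pderiv j (pderiv i p) := by
  classical
  rcases eq_or_ne i j with rfl | hij
  · rfl
  · ext m
    simp only [MvPolynomial.coeff_pderiv, Finsupp.add_apply, Finsupp.single_eq_of_ne hij,
      Finsupp.single_eq_of_ne hij.symm, add_zero, add_right_comm m]
    ring

theorem pderiv_foldl (L : List σ) (α : σ → ℕ) (i : σ) (p : MvPolynomial σ ℚ) :
    pderiv i (L.foldl (fun q j => (⇑(pderiv j))^[α j] q) p) =
      L.foldl (fun q j => (⇑(pderiv j))^[α j] q) (pderiv i p) := by
  induction L generalizing p with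
  | nil => rfl
  | cons j L ih =>
    have h : Function.Commute (⇑(pderiv (R := ℚ) i)) (⇑(pderiv j)) :=
      fun q => pderiv_pderiv_comm i j q
    simp only [List.foldl_cons, ih]
    rw [(h.iterate_right (α j)).eq]

theorem foldl_pderiv_congr {L : List σ} {α β : σ → ℕ} (h : ∀ j ∈ L, α j = β j)
    (p : MvPolynomial σ ℚ) :
    L.foldl (fun q j => (⇑(pderiv j))^[α j] q) p =
      L.foldl (fun q j => (⇑(pderiv j))^[β j] q) p := by
  induction L generalizing p with
  | nil => rfl
  | cons j L ih =>
    simp only [List.foldl_cons, h j List.mem_cons_self]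
    exact ih (fun k hk => h k (List.mem_cons_of_mem _ hk)) _

theorem foldl_pderiv_add_single [DecidableEq σ] {L : List σ} (hL : L.Nodup) {i : σ} (hi : i ∈ L)
    (α : σ → ℕ) (p : MvPolynomial σ ℚ) :
    L.foldl (fun q j => (⇑(pderiv j))^[(α + Pi.single i 1 : σ → ℕ) j] q) p =
      L.foldl (fun q j => (⇑(pderiv j))^[α j] q) (pderiv i p) := by
  induction L generalizing p with
  | nil => simp at hi
  | cons j L ih =>
    rw [List.nodup_cons] at hL
    rcases eq_or_ne i j with rfl | hij
    · simp only [List.foldl_cons, Pi.add_apply, Pi.single_eq_same, Function.iterate_succ_apply]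
      refine foldl_pderiv_congr (fun k hk => ?_) _
      have : k ≠ i := fun h => hL.1 (h ▸ hk)
      simp [this]
    · have h : Function.Commute (⇑(pderiv (R := ℚ) i)) (⇑(pderiv j)) :=
        fun q => pderiv_pderiv_comm i j q
      simp only [List.foldl_cons]
      rw [ih hL.2 ((List.mem_cons.1 hi).resolve_left hij), (h.iterate_right _).eq]
      simp [hij.symm]

theorem coeff_iterate_pderiv (i : σ) (n : ℕ) (ν : σ →₀ ℕ) (p : MvPolynomial σ ℚ) :
    MvPolynomial.coeff ν ((⇑(pderiv i))^[n] p) =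
      (∏ t ∈ Finset.range n, ((ν i : ℚ) + t + 1)) * MvPolynomial.coeff (ν + Finsupp.single i n) p := by
  induction n generalizing p with
  | zero => simp
  | succ n ih =>
    rw [Function.iterate_succ_apply, ih, coeff_pderiv, Finset.prod_range_succ, add_assoc ν,
      ← Finsupp.single_add]
    simp only [Finsupp.add_apply, Finsupp.single_eq_same, Nat.cast_add]
    ring

theorem coeff_foldl_pderiv {L : List σ} (hL : L.Nodup) (α : σ → ℕ) (ν : σ →₀ ℕ)
    (p : MvPolynomial σ ℚ) :
    MvPolynomial.coeff ν (L.foldl (fun q j => (⇑(pderiv j))^[α j] q) p) =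
      (L.map fun l => ∏ t ∈ Finset.range (α l), ((ν l : ℚ) + t + 1)).prod *
        MvPolynomial.coeff (ν + (L.map fun l => Finsupp.single l (α l)).sum) p := by
  induction L generalizing p with
  | nil => simp
  | cons j L ih =>
    rw [List.nodup_cons] at hL
    have hj : (L.map fun l => Finsupp.single l (α l)).sum j = 0 := by
      have : ∀ L : List σ, j ∉ L → (L.map fun l => Finsupp.single l (α l)).sum j = 0 := by
        intro L hL
        induction L with
        | nil => simp
        | cons k L ih =>
          rw [List.mem_cons, not_or] at hL
          simp [ih hL.2, Finsupp.single_eq_of_ne hL.1]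
      exact this L hL.1
    simp only [List.foldl_cons, List.map_cons, List.prod_cons, List.sum_cons]
    rw [ih hL.2, coeff_iterate_pderiv, Finsupp.add_apply, hj, add_zero, add_assoc ν,
      add_comm (Finsupp.single j (α j))]
    ring

variable [Fintype σ]

theorem pdIter_zero (p : MvPolynomial σ ℚ) : pdIter 0 p = p := by
  unfold pdIter
  induction (Finset.univ : Finset σ).toList with
  | nil => rfl
  | cons j L ih => simp

theorem pderiv_pdIter [DecidableEq σ] (i : σ) (α : σ → ℕ) (p : MvPolynomial σ ℚ) :
    pderiv i (pdIter α p) = pdIter (α + Pi.single i 1) p := by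
  unfold pdIter
  rw [foldl_pderiv_add_single (Finset.nodup_toList _) (by simp), pderiv_foldl]

theorem coeff_pdIter (α : σ → ℕ) (ν : σ →₀ ℕ) (p : MvPolynomial σ ℚ) :
    MvPolynomial.coeff ν (pdIter α p) =
      (∏ l, ∏ t ∈ Finset.range (α l), ((ν l : ℚ) + t + 1)) *
        MvPolynomial.coeff (ν + Finsupp.equivFunOnFinite.symm α) p := by
  unfold pdIter
  rw [coeff_foldl_pderiv (Finset.nodup_toList _), Finset.prod_map_toList, Finset.sum_map_toList]
  congr 3
  exact Finsupp.univ_sum_single (Finsupp.equivFunOnFinite.symm α)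

/-- The families `m ↦ P(m) • h m`, where `P` runs over the ring of differential operators
with coefficients polynomial in `m`. -/
noncomputable def bsModule (h : ℕ → MvPolynomial σ ℚ) : AddSubmonoid (ℕ → MvPolynomial σ ℚ) :=
  AddSubmonoid.closure
    {u | ∃ (α : σ → ℕ) (q : Polynomial (MvPolynomial σ ℚ)),
      u = fun m : ℕ => Polynomial.eval (m : MvPolynomial σ ℚ) q * pdIter α (h m)}

theorem satisfiesBS_iff (f g : MvPolynomial σ ℚ) (b : Polynomial ℚ) :
    SatisfiesBS f g b ↔
      (fun m : ℕ => MvPolynomial.C (Polynomial.eval (m : ℚ) b) * g * f ^ m) ∈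
        bsModule fun m => g * f ^ (m + 1) := by
  constructor
  · rintro ⟨A, p, h⟩
    have : (fun m : ℕ => MvPolynomial.C (Polynomial.eval (m : ℚ) b) * g * f ^ m) =
        ∑ α ∈ A, fun m : ℕ => Polynomial.eval (m : MvPolynomial σ ℚ) (p α) *
          pdIter α (g * f ^ (m + 1)) := by
      ext1 m
      rw [h, Finset.sum_apply]
    rw [this]
    exact sum_mem fun α _ => AddSubmonoid.subset_closure ⟨α, p α, rfl⟩
  · intro h
    suffices H : ∀ u ∈ bsModule (fun m => g * f ^ (m + 1)),
        ∃ P : (σ → ℕ) →₀ Polynomial (MvPolynomial σ ℚ), ∀ m : ℕ,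
          u m = P.sum fun α q => Polynomial.eval (m : MvPolynomial σ ℚ) q *
            pdIter α (g * f ^ (m + 1)) by
      obtain ⟨P, hP⟩ := H _ h
      exact ⟨P.support, P, hP⟩
    intro u hu
    induction hu using AddSubmonoid.closure_induction with
    | mem u hu =>
      obtain ⟨α, q, rfl⟩ := hu
      exact ⟨Finsupp.single α q, fun m => by rw [Finsupp.sum_single_index]; simp⟩
    | zero => exact ⟨0, fun m => by simp⟩
    | add u v _ _ hu hv =>
      classical
      obtain ⟨P, hP⟩ := hu
      obtain ⟨Q, hQ⟩ := hv
      refine ⟨P + Q, fun m => ?_⟩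
      rw [Finsupp.sum_add_index', Pi.add_apply, hP, hQ]
      · simp
      · intro α p q
        rw [Polynomial.eval_add, add_mul]

variable {h : ℕ → MvPolynomial σ ℚ} {u : ℕ → MvPolynomial σ ℚ}

theorem eval_mul_pdIter_mem_bsModule (h : ℕ → MvPolynomial σ ℚ) (α : σ → ℕ)
    (q : Polynomial (MvPolynomial σ ℚ)) :
    (fun m : ℕ => Polynomial.eval (m : MvPolynomial σ ℚ) q * pdIter α (h m)) ∈ bsModule h :=
  AddSubmonoid.subset_closure ⟨α, q, rfl⟩

theorem self_mem_bsModule (h : ℕ → MvPolynomial σ ℚ) : h ∈ bsModule h :=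
  AddSubmonoid.subset_closure ⟨0, 1, by ext1 m; simp [pdIter_zero]⟩

theorem eval_mul_mem_bsModule (q : Polynomial (MvPolynomial σ ℚ)) (hu : u ∈ bsModule h) :
    (fun m : ℕ => Polynomial.eval (m : MvPolynomial σ ℚ) q * u m) ∈ bsModule h := by
  induction hu using AddSubmonoid.closure_induction with
  | mem u hu =>
    obtain ⟨α, p, rfl⟩ := hu
    exact AddSubmonoid.subset_closure ⟨α, q * p, by ext1 m; simp [mul_assoc]⟩
  | zero =>
    convert zero_mem (bsModule h) using 1
    ext1 m
    simp
  | add u v _ _ hu hv =>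
    convert add_mem hu hv using 1
    ext1 m
    simp [mul_add]

theorem pderiv_mem_bsModule (i : σ) (hu : u ∈ bsModule h) :
    (fun m => pderiv i (u m)) ∈ bsModule h := by
  classical
  induction hu using AddSubmonoid.closure_induction with
  | mem u hu =>
    obtain ⟨α, q, rfl⟩ := hu
    have key : ∀ m : ℕ, pderiv i (Polynomial.eval (m : MvPolynomial σ ℚ) q) =
        Polynomial.eval (m : MvPolynomial σ ℚ)
          (q.sum fun n a => Polynomial.monomial n (pderiv i a)) := by
      intro m
      rw [Polynomial.eval_eq_sum, Polynomial.sum, map_sum, Polynomial.sum,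
        Polynomial.eval_finsetSum]
      refine Finset.sum_congr rfl fun n _ => ?_
      rw [pderiv_mul, Polynomial.eval_monomial, ← Nat.cast_pow]
      simp
    convert add_mem (eval_mul_pdIter_mem_bsModule h α (q.sum fun n a =>
      Polynomial.monomial n (pderiv i a))) (eval_mul_pdIter_mem_bsModule h (α + Pi.single i 1) q)
      using 1
    ext1 m
    rw [pderiv_mul, key, pderiv_pdIter, Pi.add_apply]
  | zero =>
    convert zero_mem (bsModule h) using 1
    ext1 m
    simp
  | add u v _ _ hu hv =>
    convert add_mem hu hv using 1
    ext1 m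
    simp

end PdIter

/-- The exponent of the monomial `x * (z * x ^ 2) ^ i * (w * y ^ 3) ^ j`. -/
noncomputable def cuspExponent (i j : ℕ) : Fin 4 →₀ ℕ :=
  Finsupp.equivFunOnFinite.symm ![2 * i + 1, 3 * j, i, j]

theorem cuspExponent_apply_zero (i j : ℕ) : cuspExponent i j 0 = 2 * i + 1 := rfl

theorem cuspExponent_apply_one (i j : ℕ) : cuspExponent i j 1 = 3 * j := rfl

theorem cuspExponent_apply_two (i j : ℕ) : cuspExponent i j 2 = i := rfl

theorem cuspExponent_apply_three (i j : ℕ) : cuspExponent i j 3 = j := rfl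

theorem monomial_cuspExponent (i j : ℕ) :
    MvPolynomial.monomial (cuspExponent i j) (1 : ℚ) =
      MvPolynomial.X 0 * ((MvPolynomial.X 2 * MvPolynomial.X 0 ^ 2) ^ i *
        (MvPolynomial.X 3 * MvPolynomial.X 1 ^ 3) ^ j) := by
  rw [MvPolynomial.monomial_eq, Finsupp.prod_fintype _ _ (by simp), Fin.prod_univ_four]
  simp [cuspExponent]
  ring

theorem X_mul_cusp_pow (m : ℕ) :
    (MvPolynomial.X 0 * (MvPolynomial.X 2 * MvPolynomial.X 0 ^ 2 +
        MvPolynomial.X 3 * MvPolynomial.X 1 ^ 3) ^ m : MvPolynomial (Fin 4) ℚ) =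
      ∑ a ∈ Finset.HasAntidiagonal.antidiagonal m,
        MvPolynomial.monomial (cuspExponent a.1 a.2) ((m.choose a.1 : ℕ) : ℚ) := by
  rw [(Commute.all _ _).add_pow', Finset.mul_sum]
  refine Finset.sum_congr rfl fun a _ => ?_
  rw [← mul_one ((m.choose a.1 : ℕ) : ℚ), ← MvPolynomial.C_mul_monomial, monomial_cuspExponent,
    nsmul_eq_mul, map_natCast]
  ring

/-- The family `m ↦ (m + 1) * Q(θ_z, θ_w) • (x * f ^ m)` with `f = z * x ^ 2 + w * y ^ 3`. -/
noncomputable def cuspFamily (Q : ℕ → ℕ → ℚ) (m : ℕ) : MvPolynomial (Fin 4) ℚ :=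
  ∑ a ∈ Finset.HasAntidiagonal.antidiagonal m,
    MvPolynomial.monomial (cuspExponent a.1 a.2) ((m + 1) * m.choose a.1 * Q a.1 a.2)

/-- The `D[s]`-module generated by `x * f ^ (s + 1)` with `f = z * x ^ 2 + w * y ^ 3`. -/
noncomputable abbrev cuspModule : AddSubmonoid (ℕ → MvPolynomial (Fin 4) ℚ) :=
  bsModule fun m => MvPolynomial.X 0 * (MvPolynomial.X 2 * MvPolynomial.X 0 ^ 2 +
    MvPolynomial.X 3 * MvPolynomial.X 1 ^ 3) ^ (m + 1)

theorem cuspFamily_add_mem {P Q : ℕ → ℕ → ℚ} (hP : cuspFamily P ∈ cuspModule)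
    (hQ : cuspFamily Q ∈ cuspModule) : cuspFamily (fun i j => P i j + Q i j) ∈ cuspModule := by
  convert add_mem hP hQ using 1
  ext1 m
  simp only [cuspFamily, Pi.add_apply, ← Finset.sum_add_distrib, ← map_add, mul_add]

theorem cuspFamily_X_mul_pderiv_mem {Q : ℕ → ℕ → ℚ} (hQ : cuspFamily Q ∈ cuspModule)
    (l : Fin 4) : cuspFamily (fun i j => cuspExponent i j l * Q i j) ∈ cuspModule := by
  convert eval_mul_mem_bsModule (Polynomial.C (MvPolynomial.X l)) (pderiv_mem_bsModule l hQ)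
    using 1
  ext1 m
  simp only [cuspFamily, Polynomial.eval_C, map_sum, Finset.mul_sum,
    MvPolynomial.X_mul_pderiv_monomial]
  refine Finset.sum_congr rfl fun a _ => ?_
  rw [← map_nsmul, nsmul_eq_mul]
  congr 1
  ring

theorem cuspFamily_eval_mul_mem {Q : ℕ → ℕ → ℚ} (hQ : cuspFamily Q ∈ cuspModule)
    (P : MvPolynomial (Fin 2) ℚ) :
    cuspFamily (fun i j => MvPolynomial.eval ![(i : ℚ), (j : ℚ)] P * Q i j) ∈ cuspModule := by
  induction P using MvPolynomial.induction_on generalizing Q with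
  | C c =>
    convert eval_mul_mem_bsModule (Polynomial.C (MvPolynomial.C c)) hQ using 1
    ext1 m
    simp only [cuspFamily, Polynomial.eval_C, Finset.mul_sum, MvPolynomial.C_mul_monomial,
      MvPolynomial.eval_C]
    refine Finset.sum_congr rfl fun a _ => ?_
    congr 1
    ring
  | add P R hP hR => simpa only [map_add, add_mul] using cuspFamily_add_mem (hP hQ) (hR hQ)
  | mul_X P k hP =>
    fin_cases k
    · simpa [cuspExponent, mul_assoc] using hP (cuspFamily_X_mul_pderiv_mem hQ 2)
    · simpa [cuspExponent, mul_assoc] using hP (cuspFamily_X_mul_pderiv_mem hQ 3)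

theorem cuspFamily_left_mem :
    cuspFamily (fun i _ => (2 * i + 2) * (2 * i + 3)) ∈ cuspModule := by
  convert show _ ∈ cuspModule from pderiv_mem_bsModule 2
    (pderiv_mem_bsModule 0 (pderiv_mem_bsModule 0 (self_mem_bsModule _))) using 1
  ext1 m
  simp only [X_mul_cusp_pow, Finset.Nat.sum_antidiagonal_succ, map_add, map_sum, pderiv_monomial,
    cuspFamily]
  refine (zero_add _).symm.trans (congrArg₂ _ ?_ ?_)
  · simp [cuspExponent]
  · refine Finset.sum_congr rfl fun a _ => ?_
    refine congrArg₂ (fun s c => MvPolynomial.monomial s c) ?_ ?_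
    · ext l
      have hl : l = 0 ∨ l = 1 ∨ l = 2 ∨ l = 3 := by omega
      simp only [Finsupp.tsub_apply, Finsupp.single_apply]
      rcases hl with rfl | rfl | rfl | rfl
      all_goals
        simp [cuspExponent_apply_zero, cuspExponent_apply_one, cuspExponent_apply_two,
          cuspExponent_apply_three]
      all_goals omega
    · have h : ((m : ℚ) + 1) * m.choose a.1 = (m + 1).choose (a.1 + 1) * (a.1 + 1) := by
        exact_mod_cast Nat.add_one_mul_choose_eq m a.1
      rw [h]
      simp only [Finsupp.tsub_apply, cuspExponent_apply_zero, cuspExponent_apply_two,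
        Finsupp.single_apply]
      simp
      ring

theorem cuspFamily_right_mem :
    cuspFamily (fun _ j => (3 * j + 1) * (3 * j + 2) * (3 * j + 3)) ∈ cuspModule := by
  convert show _ ∈ cuspModule from pderiv_mem_bsModule 3
    (pderiv_mem_bsModule 1 (pderiv_mem_bsModule 1 (pderiv_mem_bsModule 1 (self_mem_bsModule _)))) using 1
  ext1 m
  simp only [X_mul_cusp_pow, Finset.Nat.sum_antidiagonal_succ', map_add, map_sum, pderiv_monomial,
    cuspFamily]
  refine (zero_add _).symm.trans (congrArg₂ _ ?_ ?_)
  · simp [cuspExponent]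
  · refine Finset.sum_congr rfl fun a ha => ?_
    rw [Finset.HasAntidiagonal.mem_antidiagonal] at ha
    refine congrArg₂ (fun s c => MvPolynomial.monomial s c) ?_ ?_
    · ext l
      have hl : l = 0 ∨ l = 1 ∨ l = 2 ∨ l = 3 := by omega
      simp only [Finsupp.tsub_apply, Finsupp.single_apply]
      rcases hl with rfl | rfl | rfl | rfl
      all_goals
        simp [cuspExponent_apply_zero, cuspExponent_apply_one, cuspExponent_apply_two,
          cuspExponent_apply_three]
      all_goals omega
    · have h : ((m : ℚ) + 1) * m.choose a.1 = (m + 1).choose a.1 * (a.2 + 1) := by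
        have := Nat.add_one_mul_choose_eq m a.2
        rw [Nat.choose_symm_of_eq_add ha.symm, Nat.choose_symm_of_eq_add
          (show m + 1 = a.1 + (a.2 + 1) by omega)]
        exact_mod_cast this
      rw [h]
      simp only [Finsupp.tsub_apply, cuspExponent_apply_one, cuspExponent_apply_three,
        Finsupp.single_apply]
      have h₁ : 3 * (a.2 + 1) - 1 - 1 = 3 * a.2 + 1 := by omega
      simp [h₁]
      ring

theorem satisfiesBS_of_dvd {b : Polynomial ℚ}
    (hb : (Polynomial.X + Polynomial.C (1 : ℚ)) *
            (Polynomial.X + Polynomial.C (4 / 3 : ℚ)) *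
            (Polynomial.X + Polynomial.C (5 / 3 : ℚ)) *
            (Polynomial.X + Polynomial.C (11 / 6 : ℚ)) *
            (Polynomial.X + Polynomial.C (2 : ℚ)) *
            (Polynomial.X + Polynomial.C (13 / 6 : ℚ)) *
            (Polynomial.X + Polynomial.C (5 / 2 : ℚ)) ∣ b) :
    SatisfiesBS (MvPolynomial.X 2 * MvPolynomial.X 0 ^ 2 +
      MvPolynomial.X 3 * MvPolynomial.X 1 ^ 3 : MvPolynomial (Fin 4) ℚ)
      (MvPolynomial.X 0) b := by
  obtain ⟨q, rfl⟩ := hb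
  rw [satisfiesBS_iff]
  let x : MvPolynomial (Fin 2) ℚ := MvPolynomial.X 0
  let y : MvPolynomial (Fin 2) ℚ := MvPolynomial.X 1
  let r (t : MvPolynomial (Fin 2) ℚ) : MvPolynomial (Fin 2) ℚ :=
    3 * y ^ 2 + 3 * y * t + t ^ 2 + 2 * (2 * y + t) + MvPolynomial.C (11 / 9)
  let g : MvPolynomial (Fin 2) ℚ :=
    (y + 1) * (y + MvPolynomial.C (2 / 3)) * (y + MvPolynomial.C (1 / 3))
  let x₁ := x + 1
  let x₂ := x + MvPolynomial.C (3 / 2)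
  let q' : MvPolynomial (Fin 2) ℚ := Polynomial.aeval (x + y) q
  have h := cuspFamily_add_mem
    (cuspFamily_eval_mul_mem cuspFamily_left_mem
      (MvPolynomial.C (1 / 4) * (r x₁ * r x₂) * q'))
    (cuspFamily_eval_mul_mem cuspFamily_right_mem
      (MvPolynomial.C (1 / 27) * (g + x₁ * r x₁ + x₂ * r x₂) * q'))
  change _ ∈ cuspModule
  convert h using 1
  ext1 m
  rw [mul_assoc, X_mul_cusp_pow, Finset.mul_sum, cuspFamily]
  refine Finset.sum_congr rfl fun a ha => ?_
  rw [Finset.HasAntidiagonal.mem_antidiagonal] at ha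
  subst ha
  have hq : MvPolynomial.eval ![(a.1 : ℚ), (a.2 : ℚ)] q' = q.eval ((a.1 : ℚ) + a.2) := by
    rw [← MvPolynomial.coe_aeval_eq_eval, RingHom.coe_coe, ← Polynomial.aeval_algHom_apply]
    simp [x, y]
  rw [MvPolynomial.C_mul_monomial]
  congr 1
  simp only [map_mul, map_add, hq, x₁, x₂, r, g, x, y]
  simp
  ring

theorem coeff_X_mul_cusp_pow {ν : Fin 4 →₀ ℕ} (h₀ : ν 0 = 2 * ν 2 + 1) (h₁ : ν 1 = 3 * ν 3)
    {m : ℕ} (hm : ν 2 + ν 3 = m) :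
    MvPolynomial.coeff ν (MvPolynomial.X 0 * (MvPolynomial.X 2 * MvPolynomial.X 0 ^ 2 +
      MvPolynomial.X 3 * MvPolynomial.X 1 ^ 3) ^ m : MvPolynomial (Fin 4) ℚ) =
        m.choose (ν 2) := by
  have hν : ν = cuspExponent (ν 2) (ν 3) := by
    ext l
    have hl : l = 0 ∨ l = 1 ∨ l = 2 ∨ l = 3 := by omega
    rcases hl with rfl | rfl | rfl | rfl
    exacts [h₀, h₁, rfl, rfl]
  rw [X_mul_cusp_pow, MvPolynomial.coeff_sum, Finset.sum_eq_single (ν 2, ν 3)]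
  · rw [MvPolynomial.coeff_monomial, if_pos hν.symm]
  · intro a _ ha
    rw [MvPolynomial.coeff_monomial, if_neg]
    rintro rfl
    exact ha rfl
  · simp [hm]

theorem coeff_X_mul_cusp_pow_eq_zero {ν : Fin 4 →₀ ℕ} {m : ℕ}
    (h : ¬(ν 0 = 2 * ν 2 + 1 ∧ ν 1 = 3 * ν 3 ∧ ν 2 + ν 3 = m)) :
    MvPolynomial.coeff ν (MvPolynomial.X 0 * (MvPolynomial.X 2 * MvPolynomial.X 0 ^ 2 +
      MvPolynomial.X 3 * MvPolynomial.X 1 ^ 3) ^ m : MvPolynomial (Fin 4) ℚ) = 0 := by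
  rw [X_mul_cusp_pow, MvPolynomial.coeff_sum]
  refine Finset.sum_eq_zero fun a ha => ?_
  rw [MvPolynomial.coeff_monomial, if_neg]
  rintro rfl
  exact h ⟨rfl, rfl, Finset.HasAntidiagonal.mem_antidiagonal.1 ha⟩

theorem choose_mul_prod_range (i : ℕ) {j l : ℕ} (hl : l ≤ j) :
    ((i + j + 1).choose (i + l + 1) : ℚ) * ∏ t ∈ Finset.range (l + 1), ((i : ℚ) + t + 1) =
      (i + j).choose i * ((i + j + 1) * ∏ t ∈ Finset.range l, ((j : ℚ) - t)) := by
  induction l with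
  | zero =>
    have h : ((i + j + 1 : ℕ) : ℚ) * (i + j).choose i =
        (i + j + 1).choose (i + 1) * ((i + 1 : ℕ) : ℚ) := by
      exact_mod_cast Nat.add_one_mul_choose_eq (i + j) i
    push_cast at h
    simp only [zero_add, Finset.prod_range_one, add_zero, Finset.prod_range_zero, Nat.cast_zero]
    linear_combination -h
  | succ l ih =>
    have h : ((i + j + 1).choose (i + l + 1 + 1) : ℚ) * ((i + l + 1 + 1 : ℕ) : ℚ) =
        (i + j + 1).choose (i + l + 1) * ((j : ℚ) - l) := by
      rw [← Nat.cast_sub (by omega), show j - l = i + j + 1 - (i + l + 1) by omega]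
      exact_mod_cast Nat.choose_succ_right_eq (i + j + 1) (i + l + 1)
    have ih := ih (by omega)
    rw [Finset.prod_range_succ _ (l + 1), Finset.prod_range_succ (fun t : ℕ => (j : ℚ) - t) l,
      show i + (l + 1) + 1 = i + l + 1 + 1 by ring]
    push_cast at h ⊢
    linear_combination (∏ t ∈ Finset.range (l + 1), ((i : ℚ) + t + 1)) * h + (j - l : ℚ) * ih

/-- The coefficient of `u (i + j)` at `cuspExponent i j` is, for large `i` and `j`, the product of
`(i + j).choose i` and of a polynomial in `i` and `j` which vanishes at `v`. -/
def CuspVanishesAt (v : Fin 2 → ℚ) (u : ℕ → MvPolynomial (Fin 4) ℚ) : Prop :=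
  ∃ Q : MvPolynomial (Fin 2) ℚ, MvPolynomial.eval v Q = 0 ∧ ∃ N : ℕ, ∀ i j : ℕ, N ≤ i → N ≤ j →
    MvPolynomial.coeff (cuspExponent i j) (u (i + j)) =
      (i + j).choose i * MvPolynomial.eval ![(i : ℚ), (j : ℚ)] Q

theorem CuspVanishesAt.zero (v : Fin 2 → ℚ) : CuspVanishesAt v 0 :=
  ⟨0, by simp, 0, by simp⟩

theorem CuspVanishesAt.add {v : Fin 2 → ℚ} {u₁ u₂ : ℕ → MvPolynomial (Fin 4) ℚ}
    (h₁ : CuspVanishesAt v u₁) (h₂ : CuspVanishesAt v u₂) : CuspVanishesAt v (u₁ + u₂) := by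
  obtain ⟨Q₁, hv₁, N₁, hN₁⟩ := h₁
  obtain ⟨Q₂, hv₂, N₂, hN₂⟩ := h₂
  refine ⟨Q₁ + Q₂, by rw [map_add, hv₁, hv₂, add_zero], max N₁ N₂, fun i j hi hj => ?_⟩
  rw [Pi.add_apply, MvPolynomial.coeff_add, hN₁ i j (by omega) (by omega),
    hN₂ i j (by omega) (by omega), map_add, mul_add]

theorem coeff_monomial_mul_pdIter {i j : ℕ} {β : Fin 4 →₀ ℕ} (hi : β 0 ≤ i) (hj : β 1 ≤ j)
    (hi' : β 2 ≤ i) (hj' : β 3 ≤ j) (α : Fin 4 → ℕ) (c r : ℚ) (p : MvPolynomial (Fin 4) ℚ) :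
    MvPolynomial.coeff (cuspExponent i j)
        (MvPolynomial.monomial β c * MvPolynomial.C r * pdIter α p) =
      c * r * ((∏ t ∈ Finset.range (α 0), (2 * (i : ℚ) + 1 - β 0 + t + 1)) *
        (∏ t ∈ Finset.range (α 1), (3 * (j : ℚ) - β 1 + t + 1)) *
        (∏ t ∈ Finset.range (α 2), ((i : ℚ) - β 2 + t + 1)) *
        (∏ t ∈ Finset.range (α 3), ((j : ℚ) - β 3 + t + 1))) *
        MvPolynomial.coeff (cuspExponent i j - β + Finsupp.equivFunOnFinite.symm α) p := by
  have hβ : β ≤ cuspExponent i j := by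
    intro l
    have hl : l = 0 ∨ l = 1 ∨ l = 2 ∨ l = 3 := by omega
    rcases hl with rfl | rfl | rfl | rfl <;>
      simp only [cuspExponent_apply_zero, cuspExponent_apply_one, cuspExponent_apply_two,
        cuspExponent_apply_three] <;> omega
  have h₀ := hβ 0
  have h₁ := hβ 1
  rw [cuspExponent_apply_zero] at h₀
  rw [cuspExponent_apply_one] at h₁
  rw [mul_assoc, MvPolynomial.coeff_monomial_mul', if_pos hβ, MvPolynomial.coeff_C_mul,
    coeff_pdIter, Fin.prod_univ_four]
  simp only [Finsupp.tsub_apply, cuspExponent_apply_zero, cuspExponent_apply_one,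
    cuspExponent_apply_two, cuspExponent_apply_three, Nat.cast_sub h₀, Nat.cast_sub h₁,
    Nat.cast_sub hi', Nat.cast_sub hj']
  push_cast
  ring

variable {v : Fin 2 → ℚ}

theorem cuspVanishesAt_monomial (hv : v 0 + v 1 + 1 = 0 ∨
      (2 * v 0 + 2) * (2 * v 0 + 3) = 0 ∧ (3 * v 1 + 1) * (3 * v 1 + 2) * (3 * v 1 + 3) = 0)
    (α : Fin 4 → ℕ) (k : ℕ) (β : Fin 4 →₀ ℕ) (c : ℚ) :
    CuspVanishesAt v fun m => MvPolynomial.monomial β c * MvPolynomial.C ((m : ℚ) ^ k) *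
      pdIter α (MvPolynomial.X 0 * (MvPolynomial.X 2 * MvPolynomial.X 0 ^ 2 +
        MvPolynomial.X 3 * MvPolynomial.X 1 ^ 3) ^ (m + 1)) := by
  let x : MvPolynomial (Fin 2) ℚ := MvPolynomial.X 0
  let y : MvPolynomial (Fin 2) ℚ := MvPolynomial.X 1
  by_cases hK : α 2 + α 3 = β 2 + β 3 + 1 ∧ α 0 + 2 * β 2 = β 0 + 2 * α 2 ∧
    α 1 + 3 * β 3 = β 1 + 3 * α 3
  · obtain ⟨hK₁, hK₂, hK₃⟩ := hK
    rcases lt_or_ge (β 2) (α 2) with h | h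
    · obtain ⟨l, hl⟩ := Nat.exists_eq_add_of_le (Nat.succ_le_iff.2 h)
      refine ⟨MvPolynomial.C c * (x + y) ^ k * (x + y + 1) *
        ((∏ t ∈ Finset.range (α 0), (2 * x + 1 - MvPolynomial.C (β 0 : ℚ) + MvPolynomial.C (t : ℚ) + 1)) *
        (∏ t ∈ Finset.range (α 1), (3 * y - MvPolynomial.C (β 1 : ℚ) + MvPolynomial.C (t : ℚ) + 1)) *
        (∏ t ∈ Finset.range (β 2), (x - MvPolynomial.C (β 2 : ℚ) + MvPolynomial.C (t : ℚ) + 1)) *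
        (∏ t ∈ Finset.range (α 3), (y - MvPolynomial.C (β 3 : ℚ) + MvPolynomial.C (t : ℚ) + 1))) *
        ∏ t ∈ Finset.range l, (y - MvPolynomial.C (t : ℚ)), ?_, β 0 + β 1 + β 2 + β 3, fun i j hi hj => ?_⟩
      · rcases hv with hv | ⟨hv, -⟩
        · simp [x, y, hv]
        · have : ∏ t ∈ Finset.range (α 0), (2 * v 0 + 1 - β 0 + t + 1) = 0 := by
            rcases mul_eq_zero.1 hv with hv | hv
            · refine Finset.prod_eq_zero (i := β 0) (Finset.mem_range.2 (by omega)) ?_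
              linear_combination hv
            · refine Finset.prod_eq_zero (i := β 0 + 1) (Finset.mem_range.2 (by omega)) ?_
              push_cast
              linear_combination hv
          simp [x, y, map_prod, this]
      · have key := choose_mul_prod_range i (show l ≤ j by omega)
        rw [coeff_monomial_mul_pdIter (by omega) (by omega) (by omega) (by omega),
          coeff_X_mul_cusp_pow]
        · simp only [Finsupp.add_apply, Finsupp.tsub_apply, Finsupp.equivFunOnFinite_symm_apply_apply,
            cuspExponent_apply_two]
          rw [show i - β 2 + α 2 = i + l + 1 by omega,
            show Finset.range (α 2) = Finset.range (β 2 + (l + 1)) by rw [hl]; congr 1; omega,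
            Finset.prod_range_add]
          have h₂ : ∏ t ∈ Finset.range (l + 1), ((i : ℚ) - β 2 + (β 2 + t : ℕ) + 1) =
              ∏ t ∈ Finset.range (l + 1), ((i : ℚ) + t + 1) :=
            Finset.prod_congr rfl fun t _ => by push_cast; ring
          rw [h₂]
          simp [x, y, map_prod]
          linear_combination c * (i + j : ℚ) ^ k *
            ((∏ t ∈ Finset.range (α 0), (2 * (i : ℚ) + 1 - β 0 + t + 1)) *
            (∏ t ∈ Finset.range (α 1), (3 * (j : ℚ) - β 1 + t + 1)) *
            (∏ t ∈ Finset.range (β 2), ((i : ℚ) - β 2 + t + 1)) *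
            (∏ t ∈ Finset.range (α 3), ((j : ℚ) - β 3 + t + 1))) * key
        all_goals
          simp only [Finsupp.add_apply, Finsupp.tsub_apply, cuspExponent_apply_zero,
            cuspExponent_apply_one, cuspExponent_apply_two, cuspExponent_apply_three,
            Finsupp.equivFunOnFinite_symm_apply_apply]
          omega
    · obtain ⟨l, hl⟩ := Nat.exists_eq_add_of_le h
      refine ⟨MvPolynomial.C c * (x + y) ^ k * (x + y + 1) *
        ((∏ t ∈ Finset.range (α 0), (2 * x + 1 - MvPolynomial.C (β 0 : ℚ) + MvPolynomial.C (t : ℚ) + 1)) *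
        (∏ t ∈ Finset.range (α 1), (3 * y - MvPolynomial.C (β 1 : ℚ) + MvPolynomial.C (t : ℚ) + 1)) *
        (∏ t ∈ Finset.range (α 2), (x - MvPolynomial.C (β 2 : ℚ) + MvPolynomial.C (t : ℚ) + 1)) *
        (∏ t ∈ Finset.range (β 3), (y - MvPolynomial.C (β 3 : ℚ) + MvPolynomial.C (t : ℚ) + 1))) *
        ∏ t ∈ Finset.range l, (x - MvPolynomial.C (t : ℚ)), ?_, β 0 + β 1 + β 2 + β 3, fun i j hi hj => ?_⟩
      · rcases hv with hv | ⟨-, hv⟩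
        · simp [x, y, hv]
        · have : ∏ t ∈ Finset.range (α 1), (3 * v 1 - β 1 + t + 1) = 0 := by
            rcases mul_eq_zero.1 hv with hv | hv
            · rcases mul_eq_zero.1 hv with hv | hv
              · refine Finset.prod_eq_zero (i := β 1) (Finset.mem_range.2 (by omega)) ?_
                linear_combination hv
              · refine Finset.prod_eq_zero (i := β 1 + 1) (Finset.mem_range.2 (by omega)) ?_
                push_cast
                linear_combination hv
            · refine Finset.prod_eq_zero (i := β 1 + 2) (Finset.mem_range.2 (by omega)) ?_
              push_cast
              linear_combination hv
          simp [x, y, map_prod, this]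
      · have key := choose_mul_prod_range j (show l ≤ i by omega)
        rw [show (j + i + 1).choose (j + l + 1) = (i + j + 1).choose (i - l) by
          rw [add_comm j i]; exact Nat.choose_symm_of_eq_add (by omega),
          add_comm j i, Nat.choose_symm_add.symm] at key
        rw [coeff_monomial_mul_pdIter (by omega) (by omega) (by omega) (by omega),
          coeff_X_mul_cusp_pow]
        · simp only [Finsupp.add_apply, Finsupp.tsub_apply, Finsupp.equivFunOnFinite_symm_apply_apply,
            cuspExponent_apply_two]
          rw [show i - β 2 + α 2 = i - l by omega,
            show Finset.range (α 3) = Finset.range (β 3 + (l + 1)) by congr 1; omega,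
            Finset.prod_range_add]
          have h₂ : ∏ t ∈ Finset.range (l + 1), ((j : ℚ) - β 3 + (β 3 + t : ℕ) + 1) =
              ∏ t ∈ Finset.range (l + 1), ((j : ℚ) + t + 1) :=
            Finset.prod_congr rfl fun t _ => by push_cast; ring
          rw [h₂]
          simp [x, y, map_prod]
          linear_combination c * (i + j : ℚ) ^ k *
            ((∏ t ∈ Finset.range (α 0), (2 * (i : ℚ) + 1 - β 0 + t + 1)) *
            (∏ t ∈ Finset.range (α 1), (3 * (j : ℚ) - β 1 + t + 1)) *
            (∏ t ∈ Finset.range (α 2), ((i : ℚ) - β 2 + t + 1)) *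
            (∏ t ∈ Finset.range (β 3), ((j : ℚ) - β 3 + t + 1))) * key
        all_goals
          simp only [Finsupp.add_apply, Finsupp.tsub_apply, cuspExponent_apply_zero,
            cuspExponent_apply_one, cuspExponent_apply_two, cuspExponent_apply_three,
            Finsupp.equivFunOnFinite_symm_apply_apply]
          omega
  · refine ⟨0, map_zero _, β 0 + β 1 + β 2 + β 3, fun i j hi hj => ?_⟩
    rw [coeff_monomial_mul_pdIter (by omega) (by omega) (by omega) (by omega),
      coeff_X_mul_cusp_pow_eq_zero]
    · simp
    · simp only [Finsupp.add_apply, Finsupp.tsub_apply, cuspExponent_apply_zero,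
        cuspExponent_apply_one, cuspExponent_apply_two, cuspExponent_apply_three,
        Finsupp.equivFunOnFinite_symm_apply_apply]
      omega

theorem CuspVanishesAt.of_mem (hv : v 0 + v 1 + 1 = 0 ∨
      (2 * v 0 + 2) * (2 * v 0 + 3) = 0 ∧ (3 * v 1 + 1) * (3 * v 1 + 2) * (3 * v 1 + 3) = 0)
    {u : ℕ → MvPolynomial (Fin 4) ℚ} (hu : u ∈ cuspModule) : CuspVanishesAt v u := by
  induction hu using AddSubmonoid.closure_induction with
  | mem u hu =>
    obtain ⟨α, q, rfl⟩ := hu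
    induction q using Polynomial.induction_on' with
    | add p q hp hq =>
      simp only [Polynomial.eval_add, add_mul]
      exact hp.add hq
    | monomial k a =>
      induction a using MvPolynomial.induction_on' with
      | monomial β c =>
        convert cuspVanishesAt_monomial hv α k β c using 2
        simp
      | add a₁ a₂ h₁ h₂ =>
        simp only [map_add, Polynomial.eval_add, add_mul]
        exact h₁.add h₂
  | zero => exact .zero v
  | add u₁ u₂ _ _ h₁ h₂ => exact h₁.add h₂

theorem SatisfiesBS.eval_eq_zero {b : Polynomial ℚ}
    (hb : SatisfiesBS (MvPolynomial.X 2 * MvPolynomial.X 0 ^ 2 +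
      MvPolynomial.X 3 * MvPolynomial.X 1 ^ 3 : MvPolynomial (Fin 4) ℚ) (MvPolynomial.X 0) b)
    (hv : v 0 + v 1 + 1 = 0 ∨
      (2 * v 0 + 2) * (2 * v 0 + 3) = 0 ∧ (3 * v 1 + 1) * (3 * v 1 + 2) * (3 * v 1 + 3) = 0) :
    b.eval (v 0 + v 1) = 0 := by
  obtain ⟨Q, hQ, N, hN⟩ := CuspVanishesAt.of_mem hv ((satisfiesBS_iff _ _ _).1 hb)
  have heval (w : Fin 2 → ℚ) : MvPolynomial.eval w (Polynomial.aeval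
      (MvPolynomial.X 0 + MvPolynomial.X 1 : MvPolynomial (Fin 2) ℚ) b) =
        b.eval (w 0 + w 1) := by
    rw [← MvPolynomial.coe_aeval_eq_eval, RingHom.coe_coe, ← Polynomial.aeval_algHom_apply]
    simp
  rw [← heval, ← hQ]
  congr 1
  refine MvPolynomial.funext_set (fun _ => (Nat.cast '' Set.Ici N : Set ℚ))
    (fun _ => (Set.Ici_infinite N).image Nat.cast_injective.injOn) fun w hw => ?_
  obtain ⟨i, hi, hwi⟩ := hw 0 trivial
  obtain ⟨j, hj, hwj⟩ := hw 1 trivial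
  have hw : w = ![(i : ℚ), (j : ℚ)] := by
    ext l
    fin_cases l
    exacts [hwi.symm, hwj.symm]
  have h := hN i j hi hj
  beta_reduce at h
  rw [mul_assoc, MvPolynomial.coeff_C_mul, coeff_X_mul_cusp_pow (by rfl) (by rfl) (by rfl),
    cuspExponent_apply_two, mul_comm] at h
  have h := mul_left_cancel₀ (Nat.cast_ne_zero.2 (Nat.choose_pos (Nat.le_add_right i j)).ne') h
  rw [heval, hw, ← h]
  simp

theorem bernsteinSato_stmt_9 :
    ∀ b : Polynomial ℚ,
      SatisfiesBS (X 2 * (X 0) ^ 2 + X 3 * (X 1) ^ 3 : MvPolynomial (Fin 4) ℚ)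
          (X 0) b ↔
        (Polynomial.X + Polynomial.C (1 : ℚ)) *
            (Polynomial.X + Polynomial.C (4 / 3 : ℚ)) *
            (Polynomial.X + Polynomial.C (5 / 3 : ℚ)) *
            (Polynomial.X + Polynomial.C (11 / 6 : ℚ)) *
            (Polynomial.X + Polynomial.C (2 : ℚ)) *
            (Polynomial.X + Polynomial.C (13 / 6 : ℚ)) *
            (Polynomial.X + Polynomial.C (5 / 2 : ℚ)) ∣ b := by
  intro b
  refine ⟨fun hb => ?_, satisfiesBS_of_dvd⟩
  have hroot (c d : ℚ) (h : c + d + 1 = 0 ∨ (2 * c + 2) * (2 * c + 3) = 0 ∧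
      (3 * d + 1) * (3 * d + 2) * (3 * d + 3) = 0) (r : ℚ) (hr : c + d = -r) :
      Polynomial.X + Polynomial.C r ∣ b := by
    rw [← sub_neg_eq_add, ← map_neg, Polynomial.dvd_iff_isRoot, ← hr]
    exact hb.eval_eq_zero (v := ![c, d]) h
  have hcop (r t : ℚ) (h : r ≠ t) :
      IsCoprime (Polynomial.X + Polynomial.C r) (Polynomial.X + Polynomial.C t) := by
    have := Polynomial.isCoprime_X_sub_C_of_isUnit_sub
      (sub_ne_zero.2 (neg_injective.ne h)).isUnit
    simpa using this
  have h₁ := hroot (-1) 0 (by norm_num) 1 (by norm_num)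
  have h₂ := hroot (-1) (-1 / 3) (by norm_num) (4 / 3) (by norm_num)
  have h₃ := hroot (-1) (-2 / 3) (by norm_num) (5 / 3) (by norm_num)
  have h₄ := hroot (-3 / 2) (-1 / 3) (by norm_num) (11 / 6) (by norm_num)
  have h₅ := hroot (-1) (-1) (by norm_num) 2 (by norm_num)
  have h₆ := hroot (-3 / 2) (-2 / 3) (by norm_num) (13 / 6) (by norm_num)
  have h₇ := hroot (-3 / 2) (-1) (by norm_num) (5 / 2) (by norm_num)
  refine IsCoprime.mul_dvd ?_ (IsCoprime.mul_dvd ?_ (IsCoprime.mul_dvd ?_ (IsCoprime.mul_dvd ?_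
    (IsCoprime.mul_dvd ?_ (IsCoprime.mul_dvd ?_ h₁ h₂) h₃) h₄) h₅) h₆) h₇
  any_goals simp only [IsCoprime.mul_left_iff]
  all_goals and_intros
  all_goals exact hcop _ _ (by norm_num)
end

section
/- Let f = z·x² + w·y³ and g = y in ℚ[x,y,z,w]. For every b ∈ ℚ[s], b satisfies the Bernstein–Sato functional equation for the pair (f, g) if and only if (s + 1)(s + 7/6)(s + 3/2)(s + 5/3)(s + 11/6)(s + 2)(s + 7/3) divides b in ℚ[s]; that is, b_{f,y}(s) = (s + 1)(s + 7/6)(s + 3/2)(s + 5/3)(s + 11/6)(s + 2)(s + 7/3). -/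
open MvPolynomial Polynomial

namespace BernsteinSato

theorem coeff_iterate_pderiv {σ : Type*} (i : σ) (n : ℕ) (p : MvPolynomial σ ℚ) (γ : σ →₀ ℕ) :
    MvPolynomial.coeff γ ((⇑(MvPolynomial.pderiv i))^[n] p) =
      MvPolynomial.coeff (γ + Finsupp.single i n) p * ((γ i + n).descFactorial n : ℚ) := by
  induction n generalizing p with
  | zero => simp
  | succ n ih =>
    rw [Function.iterate_succ_apply, ih, MvPolynomial.coeff_pderiv, add_assoc,
      ← Finsupp.single_add, ← add_assoc (γ i), Nat.succ_descFactorial_succ]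
    simp
    ring

theorem coeff_foldl_pderiv {σ : Type*} (α : σ → ℕ) (l : List σ) (hl : l.Nodup)
    (p : MvPolynomial σ ℚ) (γ : σ →₀ ℕ) :
    MvPolynomial.coeff γ (l.foldl (fun q i => (⇑(MvPolynomial.pderiv i))^[α i] q) p) =
      MvPolynomial.coeff (γ + (l.map fun i => Finsupp.single i (α i)).sum) p *
        (l.map fun i => ((γ i + α i).descFactorial (α i) : ℚ)).prod := by
  induction l generalizing p with
  | nil => simp
  | cons a l ih =>
    obtain ⟨ha, hl'⟩ := List.nodup_cons.mp hl
    have hz : (l.map fun i => Finsupp.single i (α i)).sum a = 0 := by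
      clear ih hl hl'
      induction l with
      | nil => simp
      | cons b l ih =>
        simp only [List.mem_cons, not_or] at ha
        simp [ih ha.2, Ne.symm ha.1]
    rw [List.foldl_cons, ih hl', coeff_iterate_pderiv]
    simp only [List.map_cons, List.sum_cons, List.prod_cons, Finsupp.add_apply, hz, add_zero]
    rw [add_assoc, add_comm (List.sum _)]
    ring

theorem coeff_pdIter {σ : Type*} [Fintype σ] (α : σ → ℕ) (p : MvPolynomial σ ℚ) (γ : σ →₀ ℕ) :
    MvPolynomial.coeff γ (pdIter α p) =
      MvPolynomial.coeff (γ + Finsupp.equivFunOnFinite.symm α) p *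
        ∏ i, ((γ i + α i).descFactorial (α i) : ℚ) := by
  classical
  rw [pdIter, coeff_foldl_pderiv α _ (Finset.nodup_toList _), Finset.prod_map_toList,
    Finset.sum_map_toList]
  congr 3
  ext i
  simp [Finsupp.finsetSum_apply, Finsupp.single_apply]

theorem satisfiesBS_of_fintype {σ ι : Type*} [Fintype σ] [Fintype ι] {f g : MvPolynomial σ ℚ}
    {b : Polynomial ℚ} (α : ι → σ → ℕ) (q : ι → Polynomial (MvPolynomial σ ℚ))
    (h : ∀ m : ℕ, MvPolynomial.C (Polynomial.eval (m : ℚ) b) * g * f ^ m =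
      ∑ k, Polynomial.eval (m : MvPolynomial σ ℚ) (q k) * pdIter (α k) (g * f ^ (m + 1))) :
    SatisfiesBS f g b := by
  classical
  refine ⟨Finset.univ.image α, fun a => ∑ k with α k = a, q k, fun m => ?_⟩
  rw [h m, ← Finset.sum_fiberwise_of_maps_to (g := α) (t := Finset.univ.image α) (by simp)]
  refine Finset.sum_congr rfl fun a _ => ?_
  rw [Polynomial.eval_finsetSum, Finset.sum_mul]
  refine Finset.sum_congr rfl fun k hk => ?_
  rw [(Finset.mem_filter.mp hk).2]

theorem SatisfiesBS.mul_right {σ : Type*} [Fintype σ] {f g : MvPolynomial σ ℚ}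
    {b : Polynomial ℚ} (h : SatisfiesBS f g b) (c : Polynomial ℚ) : SatisfiesBS f g (b * c) := by
  obtain ⟨A, p, h⟩ := h
  refine ⟨A, fun α => c.map MvPolynomial.C * p α, fun m => ?_⟩
  simp only [Polynomial.eval_mul, Polynomial.eval_natCast_map, mul_assoc, ← Finset.mul_sum]
  simp only [← mul_assoc] at h ⊢
  rw [mul_comm (Polynomial.eval _ b), MvPolynomial.C_mul]
  simp only [mul_assoc] at h ⊢
  rw [h m]

/-- The polynomial `z x² + w y³`. -/
noncomputable abbrev binomialForm : MvPolynomial (Fin 4) ℚ :=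
  MvPolynomial.X 2 * (MvPolynomial.X 0) ^ 2 + MvPolynomial.X 3 * (MvPolynomial.X 1) ^ 3

/-- The exponent of the monomial `y (w y³)^i (z x²)^j`. -/
noncomputable def expo (i j : ℕ) : Fin 4 →₀ ℕ :=
  Finsupp.equivFunOnFinite.symm ![2 * j, 3 * i + 1, j, i]

theorem eq_expo_iff (δ : Fin 4 →₀ ℕ) (i j : ℕ) :
    δ = expo i j ↔ δ 0 = 2 * j ∧ δ 1 = 3 * i + 1 ∧ δ 2 = j ∧ δ 3 = i := by
  rw [Finsupp.ext_iff, Fin.forall_fin_succ, Fin.forall_fin_succ, Fin.forall_fin_succ,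
    Fin.forall_fin_succ]
  simp [expo]

theorem X_mul_binomialForm_pow (n : ℕ) :
    MvPolynomial.X 1 * binomialForm ^ n =
      ∑ k ∈ Finset.range (n + 1), MvPolynomial.monomial (expo (n - k) k) (n.choose k : ℚ) := by
  rw [binomialForm, add_pow, Finset.mul_sum]
  refine Finset.sum_congr rfl fun k _ => ?_
  rw [MvPolynomial.monomial_eq, Finsupp.prod_fintype _ _ (by simp)]
  simp [Fin.prod_univ_four, expo]
  ring

theorem coeff_X_mul_binomialForm_pow (n : ℕ) (δ : Fin 4 →₀ ℕ) :
    MvPolynomial.coeff δ (MvPolynomial.X 1 * binomialForm ^ n) =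
      if δ 0 = 2 * δ 2 ∧ δ 1 = 3 * δ 3 + 1 ∧ δ 2 + δ 3 = n then (n.choose (δ 2) : ℚ) else 0 := by
  rw [X_mul_binomialForm_pow, MvPolynomial.coeff_sum]
  simp only [MvPolynomial.coeff_monomial]
  split_ifs with h
  · rw [Finset.sum_eq_single (δ 2)]
    · rw [if_pos]
      exact ((eq_expo_iff _ _ _).mpr (by omega)).symm
    · intro k _ hk
      rw [if_neg]
      intro e
      have := (eq_expo_iff _ _ _).mp e.symm
      omega
    · intro hk
      simp only [Finset.mem_range] at hk
      omega
  · refine Finset.sum_eq_zero fun k hk => ?_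
    rw [if_neg]
    intro e
    have := (eq_expo_iff _ _ _).mp e.symm
    simp only [Finset.mem_range] at hk
    omega

/-- The condition that `x^β ∂^α` maps `y f^(s+1)` into the torus weight of `y f^s`. -/
def Compatible (α : Fin 4 → ℕ) (β : Fin 4 →₀ ℕ) : Prop :=
  α 0 + 2 * β 2 = β 0 + 2 * α 2 ∧ α 1 + 3 * β 3 = β 1 + 3 * α 3 ∧ α 2 + α 3 = β 2 + β 3 + 1

theorem coeff_monomial_mul_pdIter (α : Fin 4 → ℕ) (β γ : Fin 4 →₀ ℕ) (n : ℕ) :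
    MvPolynomial.coeff γ (MvPolynomial.monomial β 1 *
        pdIter α (MvPolynomial.X 1 * binomialForm ^ n)) =
      if (∀ t, β t ≤ γ t) ∧ γ 0 - β 0 + α 0 = 2 * (γ 2 - β 2 + α 2) ∧
          γ 1 - β 1 + α 1 = 3 * (γ 3 - β 3 + α 3) + 1 ∧
          γ 2 - β 2 + α 2 + (γ 3 - β 3 + α 3) = n then
        (n.choose (γ 2 - β 2 + α 2) : ℚ) * ∏ t, ((γ t - β t + α t).descFactorial (α t) : ℚ)
      else 0 := by
  rw [MvPolynomial.coeff_monomial_mul', coeff_pdIter, coeff_X_mul_binomialForm_pow]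
  simp only [Finsupp.le_def, Finsupp.add_apply, Finsupp.tsub_apply, one_mul,
    Finsupp.equivFunOnFinite_symm_apply_apply, ite_mul, zero_mul,
    ite_and]

theorem coeff_expo_eq_zero {α : Fin 4 → ℕ} {β : Fin 4 →₀ ℕ} (h : ¬ Compatible α β) (i j : ℕ) :
    MvPolynomial.coeff (expo i j) (MvPolynomial.monomial β 1 *
        pdIter α (MvPolynomial.X 1 * binomialForm ^ (i + j + 1))) = 0 := by
  rw [coeff_monomial_mul_pdIter, if_neg]
  rintro ⟨hle, hw⟩
  obtain ⟨e0, e1, e2, e3⟩ := (eq_expo_iff _ i j).mp rfl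
  have h0 := hle 0
  have h1 := hle 1
  have h2 := hle 2
  have h3 := hle 3
  rw [e0] at h0 hw
  rw [e1] at h1 hw
  rw [e2] at h2 hw
  rw [e3] at h3 hw
  refine h ⟨?_, ?_, ?_⟩ <;> omega

theorem coeff_eq_zero_of_compatible {α : Fin 4 → ℕ} {β : Fin 4 →₀ ℕ} (h : Compatible α β)
    {m : ℕ} {γ : Fin 4 →₀ ℕ} (hγ : ¬ (γ 0 = 2 * γ 2 ∧ γ 1 = 3 * γ 3 + 1 ∧ γ 2 + γ 3 = m)) :
    MvPolynomial.coeff γ (MvPolynomial.monomial β 1 *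
        pdIter α (MvPolynomial.X 1 * binomialForm ^ (m + 1))) = 0 := by
  rw [coeff_monomial_mul_pdIter, if_neg]
  rintro ⟨hle, hw⟩
  have h0 := hle 0
  have h1 := hle 1
  have h2 := hle 2
  have h3 := hle 3
  unfold Compatible at h
  apply hγ
  omega

/-- The eigenvalue polynomial of a compatible `x^β ∂^α`, in the variables `i`, `j` of `expo`. -/
noncomputable def eigenPoly (α : Fin 4 → ℕ) (β : Fin 4 →₀ ℕ) : MvPolynomial (Fin 2) ℚ :=
  (MvPolynomial.X 0 + MvPolynomial.X 1 + 1) *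
    Polynomial.aeval (MvPolynomial.X 1) (descPochhammer ℚ (β 2)) *
    Polynomial.aeval (MvPolynomial.X 0) (descPochhammer ℚ (β 3)) *
    Polynomial.aeval (2 * MvPolynomial.X 1 + MvPolynomial.C (2 * ((α 2 : ℚ) - β 2)))
      (descPochhammer ℚ (α 0)) *
    Polynomial.aeval (3 * MvPolynomial.X 0 + MvPolynomial.C (3 * ((α 3 : ℚ) - β 3) + 1))
      (descPochhammer ℚ (α 1))

theorem eval_aeval_eq (v : Fin 2 → ℚ) (x : MvPolynomial (Fin 2) ℚ) (p : Polynomial ℚ) :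
    MvPolynomial.eval v (Polynomial.aeval x p) = p.eval (MvPolynomial.eval v x) := by
  have := Polynomial.aeval_algHom_apply (MvPolynomial.aeval (R := ℚ) v) x p
  simpa [MvPolynomial.aeval_eq_eval, Polynomial.aeval_def, Polynomial.eval₂_eq_eval_map]
    using this.symm

theorem eval_eigenPoly (α : Fin 4 → ℕ) (β : Fin 4 →₀ ℕ) (v : Fin 2 → ℚ) :
    MvPolynomial.eval v (eigenPoly α β) =
      (v 0 + v 1 + 1) * (descPochhammer ℚ (β 2)).eval (v 1) *
        (descPochhammer ℚ (β 3)).eval (v 0) *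
        (descPochhammer ℚ (α 0)).eval (2 * v 1 + 2 * ((α 2 : ℚ) - β 2)) *
        (descPochhammer ℚ (α 1)).eval (3 * v 0 + (3 * ((α 3 : ℚ) - β 3) + 1)) := by
  simp only [eigenPoly, map_mul, eval_aeval_eq]
  simp

theorem choose_mul_descFactorial_mul_descFactorial {i j k l a b : ℕ} (h : k + l = i + j + 1)
    (ha : a ≤ j) (hb : b ≤ i) (ck : j - a ≤ k) (cl : i - b ≤ l) :
    (i + j + 1).choose k * k.descFactorial (k - (j - a)) * l.descFactorial (l - (i - b)) =
      (i + j).choose j * (i + j + 1) * j.descFactorial a * i.descFactorial b := by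
  have hpos : 0 < (j - a).factorial * (i - b).factorial := by positivity
  refine Nat.eq_of_mul_eq_mul_right hpos ?_
  have e1 := Nat.factorial_mul_descFactorial (Nat.sub_le k (j - a))
  have e2 := Nat.factorial_mul_descFactorial (Nat.sub_le l (i - b))
  rw [Nat.sub_sub_self ck] at e1
  rw [Nat.sub_sub_self cl] at e2
  have e3 := Nat.factorial_mul_descFactorial ha
  have e4 := Nat.factorial_mul_descFactorial hb
  have e5 := Nat.add_choose_mul_factorial_mul_factorial l k
  rw [add_comm l k, h] at e5
  have e6 := Nat.add_choose_mul_factorial_mul_factorial i j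
  have e7 := Nat.factorial_succ (i + j)
  calc _ = (i + j + 1).choose k * ((j - a).factorial * k.descFactorial (k - (j - a))) *
        ((i - b).factorial * l.descFactorial (l - (i - b))) := by ring
    _ = (i + j + 1).choose k * l.factorial * k.factorial := by rw [e1, e2]; ring
    _ = (i + j + 1) * ((i + j).choose j * i.factorial * j.factorial) := by rw [e5, e7, e6]
    _ = (i + j + 1) * ((i + j).choose j * ((i - b).factorial * i.descFactorial b) *
        ((j - a).factorial * j.descFactorial a)) := by rw [e3, e4]
    _ = _ := by ring

theorem eval_descPochhammer_of_eq {n : ℕ} {x : ℚ} {N : ℕ} (hx : x = N) :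
    (descPochhammer ℚ n).eval x = N.descFactorial n := by
  rw [hx, descPochhammer_eval_eq_descFactorial]

theorem coeff_expo_eq_eval {α : Fin 4 → ℕ} {β : Fin 4 →₀ ℕ} (h : Compatible α β) (i j : ℕ) :
    MvPolynomial.coeff (expo i j) (MvPolynomial.monomial β 1 *
        pdIter α (MvPolynomial.X 1 * binomialForm ^ (i + j + 1))) =
      ((i + j).choose j : ℚ) * MvPolynomial.eval ![(i : ℚ), (j : ℚ)] (eigenPoly α β) := by
  rw [coeff_monomial_mul_pdIter, eval_eigenPoly]
  obtain ⟨e0, e1, e2, e3⟩ := (eq_expo_iff _ i j).mp rfl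
  simp only [Fin.forall_fin_succ, Fin.prod_univ_four, Matrix.cons_val_zero, Matrix.cons_val_one]
  simp only [Fin.succ_zero_eq_one, Fin.succ_one_eq_two, Fin.isValue, e0, e1, e2, e3]
  obtain ⟨w0, w1, w2⟩ := h
  rw [descPochhammer_eval_eq_descFactorial, descPochhammer_eval_eq_descFactorial]
  by_cases h2 : j < β 2
  · rw [Nat.descFactorial_of_lt h2, if_neg (by
      rintro ⟨⟨_, _, hh, _⟩, _⟩; exact absurd hh (by omega))]
    simp
  by_cases h3 : i < β 3
  · rw [Nat.descFactorial_of_lt h3, if_neg (by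
      rintro ⟨⟨_, _, _, hh, _⟩, _⟩
      have : β 3 ≤ i := by simpa [e3] using hh
      omega)]
    simp
  push Not at h2 h3
  have c0 : (2 * j + 2 * ((α 2 : ℚ) - β 2)) = ((2 * (j - β 2 + α 2) : ℕ) : ℚ) := by
    push_cast [Nat.cast_sub h2]
    ring
  have c1 : (3 * i + (3 * ((α 3 : ℚ) - β 3) + 1)) = ((3 * (i - β 3 + α 3) + 1 : ℕ) : ℚ) := by
    push_cast [Nat.cast_sub h3]
    ring
  rw [eval_descPochhammer_of_eq c0, eval_descPochhammer_of_eq c1]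
  by_cases h0 : 2 * j < β 0
  · rw [Nat.descFactorial_of_lt (n := 2 * (j - β 2 + α 2)) (by omega), if_neg (by
      rintro ⟨⟨hh, _⟩, _⟩; omega)]
    simp
  by_cases h1 : 3 * i + 1 < β 1
  · rw [Nat.descFactorial_of_lt (n := 3 * (i - β 3 + α 3) + 1) (by omega), if_neg (by
      rintro ⟨⟨_, hh, _⟩, _⟩; omega)]
    simp
  rw [if_pos]
  · have key := choose_mul_descFactorial_mul_descFactorial (i := i) (j := j)
      (k := j - β 2 + α 2) (l := i - β 3 + α 3) (by omega) h2 h3 (by omega) (by omega)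
    rw [Nat.add_sub_cancel_left, Nat.add_sub_cancel_left] at key
    have key' := congrArg (Nat.cast (R := ℚ)) key
    push_cast at key'
    rw [show 2 * j - β 0 + α 0 = 2 * (j - β 2 + α 2) by omega,
      show 3 * i + 1 - β 1 + α 1 = 3 * (i - β 3 + α 3) + 1 by omega]
    linear_combination ((2 * (j - β 2 + α 2)).descFactorial (α 0) : ℚ) *
      ((3 * (i - β 3 + α 3) + 1).descFactorial (α 1) : ℚ) * key'
  · refine ⟨⟨by omega, by omega, by omega, ?_, by simp⟩, by omega, by omega, by omega⟩
    simpa [e3] using h3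

theorem eval_descPochhammer_eq_zero {n k : ℕ} (hk : k < n) {x : ℚ} (hx : x = k) :
    (descPochhammer ℚ n).eval x = 0 := by
  rw [eval_descPochhammer_of_eq hx, Nat.descFactorial_of_lt hk, Nat.cast_zero]

/-- The common zeros, in the variables `i`, `j` of `expo`, of all eigenvalue polynomials. -/
def IsCommonZero (v : Fin 2 → ℚ) : Prop :=
  v 0 + v 1 = -1 ∨
    ((v 1 = -1 ∨ v 1 = -1 / 2) ∧ (v 0 = -4 / 3 ∨ v 0 = -1 ∨ v 0 = -2 / 3))

theorem eval_eigenPoly_eq_zero {α : Fin 4 → ℕ} {β : Fin 4 →₀ ℕ} (h : Compatible α β)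
    {v : Fin 2 → ℚ} (hv : IsCommonZero v) : MvPolynomial.eval v (eigenPoly α β) = 0 := by
  rw [eval_eigenPoly]
  obtain ⟨w0, w1, w2⟩ := h
  rcases hv with hv | ⟨hj, hi⟩
  · rw [hv]
    simp
  rcases Nat.lt_or_ge (β 2) (α 2) with hd | hd
  · obtain ⟨d, hd⟩ := Nat.exists_eq_add_of_lt hd
    have : (descPochhammer ℚ (α 0)).eval (2 * v 1 + 2 * ((α 2 : ℚ) - β 2)) = 0 := by
      rcases hj with hj | hj
      · refine eval_descPochhammer_eq_zero (k := 2 * d) (by omega) ?_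
        rw [hj, hd]
        push_cast
        ring
      · refine eval_descPochhammer_eq_zero (k := 2 * d + 1) (by omega) ?_
        rw [hj, hd]
        push_cast
        ring
    rw [this]
    simp
  · obtain ⟨d, hd⟩ : ∃ d, α 3 = β 3 + d + 1 := ⟨α 3 - β 3 - 1, by omega⟩
    have : (descPochhammer ℚ (α 1)).eval (3 * v 0 + (3 * ((α 3 : ℚ) - β 3) + 1)) = 0 := by
      rcases hi with hi | hi | hi
      · refine eval_descPochhammer_eq_zero (k := 3 * d) (by omega) ?_
        rw [hi, hd]
        push_cast
        ring
      · refine eval_descPochhammer_eq_zero (k := 3 * d + 1) (by omega) ?_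
        rw [hi, hd]
        push_cast
        ring
      · refine eval_descPochhammer_eq_zero (k := 3 * d + 2) (by omega) ?_
        rw [hi, hd]
        push_cast
        ring
    rw [this]
    simp

/-- The coefficients of `h m` at the monomials of `y f^m` are those of `y f^m` multiplied by the
values of a polynomial in the exponents which vanishes at `v`. -/
def IsVanishingFamily (v : Fin 2 → ℚ) (h : ℕ → MvPolynomial (Fin 4) ℚ) : Prop :=
  ∃ P : MvPolynomial (Fin 2) ℚ, MvPolynomial.eval v P = 0 ∧ ∀ i j : ℕ,
    MvPolynomial.coeff (expo i j) (h (i + j)) =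
      ((i + j).choose j : ℚ) * MvPolynomial.eval ![(i : ℚ), (j : ℚ)] P

theorem IsVanishingFamily.zero (v : Fin 2 → ℚ) : IsVanishingFamily v 0 :=
  ⟨0, by simp, by simp⟩

theorem IsVanishingFamily.add {v : Fin 2 → ℚ} {h k : ℕ → MvPolynomial (Fin 4) ℚ}
    (hh : IsVanishingFamily v h) (hk : IsVanishingFamily v k) : IsVanishingFamily v (h + k) := by
  obtain ⟨P, hP, hP'⟩ := hh
  obtain ⟨Q, hQ, hQ'⟩ := hk
  refine ⟨P + Q, by simp [hP, hQ], fun i j => ?_⟩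
  simp [hP', hQ', mul_add]

theorem IsVanishingFamily.sum {v : Fin 2 → ℚ} {ι : Type*} (A : Finset ι)
    (h : ι → ℕ → MvPolynomial (Fin 4) ℚ) (hh : ∀ a ∈ A, IsVanishingFamily v (h a)) :
    IsVanishingFamily v (∑ a ∈ A, h a) :=
  Finset.sum_induction _ _ (fun _ _ => IsVanishingFamily.add) (IsVanishingFamily.zero v) hh

theorem IsVanishingFamily.natCast_pow_mul {v : Fin 2 → ℚ} {h : ℕ → MvPolynomial (Fin 4) ℚ}
    (hh : IsVanishingFamily v h) (n : ℕ) :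
    IsVanishingFamily v fun m => (m : MvPolynomial (Fin 4) ℚ) ^ n * h m := by
  obtain ⟨P, hP, hP'⟩ := hh
  refine ⟨(MvPolynomial.X 0 + MvPolynomial.X 1) ^ n * P, by simp [hP], fun i j => ?_⟩
  beta_reduce
  rw [← map_natCast MvPolynomial.C, ← MvPolynomial.C_pow, MvPolynomial.coeff_C_mul, hP']
  simp
  ring

theorem IsVanishingFamily.C_mul {v : Fin 2 → ℚ} {h : ℕ → MvPolynomial (Fin 4) ℚ}
    (hh : IsVanishingFamily v h) (c : ℚ) :
    IsVanishingFamily v fun m => MvPolynomial.C c * h m := by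
  obtain ⟨P, hP, hP'⟩ := hh
  refine ⟨MvPolynomial.C c * P, by simp [hP], fun i j => ?_⟩
  rw [MvPolynomial.coeff_C_mul, hP']
  simp
  ring

theorem isVanishingFamily_monomial_mul_pdIter {v : Fin 2 → ℚ} (hv : IsCommonZero v)
    (α : Fin 4 → ℕ) (β : Fin 4 →₀ ℕ) :
    IsVanishingFamily v fun m => MvPolynomial.monomial β 1 *
      pdIter α (MvPolynomial.X 1 * binomialForm ^ (m + 1)) := by
  by_cases h : Compatible α β
  · exact ⟨eigenPoly α β, eval_eigenPoly_eq_zero h hv, coeff_expo_eq_eval h⟩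
  · exact ⟨0, by simp, fun i j => by simpa using coeff_expo_eq_zero h i j⟩

theorem isVanishingFamily_mul_pdIter {v : Fin 2 → ℚ} (hv : IsCommonZero v)
    (α : Fin 4 → ℕ) (a : MvPolynomial (Fin 4) ℚ) :
    IsVanishingFamily v fun m => a * pdIter α (MvPolynomial.X 1 * binomialForm ^ (m + 1)) := by
  induction a using MvPolynomial.induction_on' with
  | monomial β c =>
    have := (isVanishingFamily_monomial_mul_pdIter hv α β).C_mul c
    simpa only [← mul_assoc, MvPolynomial.C_mul_monomial, mul_one] using this
  | add p q hp hq =>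
    simp only [add_mul]
    exact hp.add hq

theorem isVanishingFamily_eval_mul_pdIter {v : Fin 2 → ℚ} (hv : IsCommonZero v)
    (α : Fin 4 → ℕ) (q : Polynomial (MvPolynomial (Fin 4) ℚ)) :
    IsVanishingFamily v fun m => Polynomial.eval (m : MvPolynomial (Fin 4) ℚ) q *
      pdIter α (MvPolynomial.X 1 * binomialForm ^ (m + 1)) := by
  induction q using Polynomial.induction_on' with
  | add p q hp hq =>
    simp only [Polynomial.eval_add, add_mul]
    exact hp.add hq
  | monomial n a =>
    have := (isVanishingFamily_mul_pdIter hv α a).natCast_pow_mul n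
    simpa only [Polynomial.eval_monomial, mul_comm a, mul_assoc] using this

theorem coeff_expo_X_mul_binomialForm_pow (i j : ℕ) :
    MvPolynomial.coeff (expo i j) (MvPolynomial.X 1 * binomialForm ^ (i + j)) =
      ((i + j).choose j : ℚ) := by
  obtain ⟨e0, e1, e2, e3⟩ := (eq_expo_iff _ i j).mp rfl
  rw [coeff_X_mul_binomialForm_pow, if_pos (by omega), e2]

theorem SatisfiesBS.isRoot {b : Polynomial ℚ}
    (h : SatisfiesBS binomialForm (MvPolynomial.X 1) b) {v : Fin 2 → ℚ} (hv : IsCommonZero v) :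
    b.IsRoot (v 0 + v 1) := by
  obtain ⟨A, p, h⟩ := h
  obtain ⟨P, hP, hP'⟩ := IsVanishingFamily.sum A _ fun α _ =>
    isVanishingFamily_eval_mul_pdIter hv α (p α)
  have key : Polynomial.aeval (MvPolynomial.X 0 + MvPolynomial.X 1) b = P := by
    refine MvPolynomial.funext_set (fun _ => Set.range (Nat.cast : ℕ → ℚ))
      (fun _ => Set.infinite_range_of_injective Nat.cast_injective) fun x hx => ?_
    obtain ⟨i, hi⟩ := hx 0 trivial
    obtain ⟨j, hj⟩ := hx 1 trivial
    have hx : x = ![(i : ℚ), (j : ℚ)] := by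
      ext t
      fin_cases t
      · exact hi.symm
      · exact hj.symm
    have e := hP' i j
    rw [Finset.sum_apply, ← h (i + j), mul_assoc, MvPolynomial.coeff_C_mul,
      coeff_expo_X_mul_binomialForm_pow, mul_comm] at e
    have hc : ((i + j).choose j : ℚ) ≠ 0 :=
      Nat.cast_ne_zero.mpr (Nat.choose_pos (Nat.le_add_left j i)).ne'
    rw [hx, ← mul_left_cancel₀ hc e, eval_aeval_eq]
    simp
  rw [Polynomial.IsRoot, ← hP, ← key, eval_aeval_eq]
  simp

/-- The polynomial `(t + 4/3) (t + 1) (t + 2/3)`. -/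
noncomputable def cubic : Polynomial ℚ :=
  (Polynomial.X + Polynomial.C (4 / 3 : ℚ)) * (Polynomial.X + Polynomial.C (1 : ℚ)) *
    (Polynomial.X + Polynomial.C (2 / 3 : ℚ))

/-- The derivative orders of the five operators in the functional equation. -/
def opOrder : Fin 5 → Fin 4 → ℕ :=
  ![![2, 0, 1, 0], ![2, 0, 2, 0], ![2, 0, 3, 0], ![0, 3, 0, 1], ![0, 3, 0, 2]]

/-- The exponents of the monomial coefficients of the five operators. -/
noncomputable def opExponent : Fin 5 → Fin 4 →₀ ℕ :=
  ![0, Finsupp.single 2 1, Finsupp.single 2 2, 0, Finsupp.single 3 1]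

/-- The coefficients in `ℚ[s]` of the five operators. -/
noncomputable def opCoeff : Fin 5 → Polynomial ℚ :=
  let s : Polynomial ℚ := Polynomial.X
  let c₁ := cubic.comp (s + Polynomial.C 1)
  let c₂ := cubic.comp (s + Polynomial.C (1 / 2))
  let t := s + Polynomial.C (1 / 2)
  let v₀ := Polynomial.C 3 * t ^ 2 + Polynomial.C 6 * t + Polynomial.C (26 / 9) -
    Polynomial.C (1 / 2) * (Polynomial.C 3 * t + Polynomial.C 3) + Polynomial.C (1 / 4)
  ![Polynomial.C (1 / 4) * (Polynomial.C 2 * (c₁ - c₂) * v₀ -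
      c₂ * (Polynomial.C 3 * s + Polynomial.C (9 / 2))),
    Polynomial.C (1 / 4) * (c₂ - Polynomial.C 2 * (c₁ - c₂) *
      (Polynomial.C 3 * s + Polynomial.C (5 / 2))),
    Polynomial.C (1 / 2) * (c₁ - c₂),
    Polynomial.C (1 / 27) * (c₂ + Polynomial.C 2 * (s + Polynomial.C 1) * (c₁ - c₂)),
    Polynomial.C (1 / 27) * (Polynomial.C (-2) * (c₁ - c₂))]

theorem compatible_op (k : Fin 5) : Compatible (opOrder k) (opExponent k) := by
  fin_cases k <;> simp [Compatible, opOrder, opExponent]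

/-- The generalized Bernstein–Sato polynomial of `z x² + w y³` with respect to `y`. -/
noncomputable def bsPoly : Polynomial ℚ :=
  (Polynomial.X + Polynomial.C (1 : ℚ)) *
    (Polynomial.X + Polynomial.C (7 / 6 : ℚ)) *
    (Polynomial.X + Polynomial.C (3 / 2 : ℚ)) *
    (Polynomial.X + Polynomial.C (5 / 3 : ℚ)) *
    (Polynomial.X + Polynomial.C (11 / 6 : ℚ)) *
    (Polynomial.X + Polynomial.C (2 : ℚ)) *
    (Polynomial.X + Polynomial.C (7 / 3 : ℚ))

theorem eval_bsPoly (i j : ℚ) :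
    bsPoly.eval (i + j) = ∑ k, (opCoeff k).eval (i + j) *
      MvPolynomial.eval ![i, j] (eigenPoly (opOrder k) (opExponent k)) := by
  simp only [eval_eigenPoly, Fin.sum_univ_five]
  simp [opOrder, opExponent, opCoeff, cubic, descPochhammer_succ_right, bsPoly]
  ring

theorem satisfiesBS_bsPoly : SatisfiesBS binomialForm (MvPolynomial.X 1) bsPoly := by
  refine satisfiesBS_of_fintype opOrder (fun k => (opCoeff k).map MvPolynomial.C *
    Polynomial.C (MvPolynomial.monomial (opExponent k) 1)) fun m => ?_
  ext γ
  simp only [MvPolynomial.coeff_sum, Polynomial.eval_mul, Polynomial.eval_natCast_map,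
    Polynomial.eval_C, mul_assoc, MvPolynomial.coeff_C_mul]
  by_cases hγ : γ 0 = 2 * γ 2 ∧ γ 1 = 3 * γ 3 + 1 ∧ γ 2 + γ 3 = m
  · obtain ⟨i, hi⟩ : ∃ i, γ 3 = i := ⟨_, rfl⟩
    obtain ⟨j, hj⟩ : ∃ j, γ 2 = j := ⟨_, rfl⟩
    obtain rfl : m = i + j := by omega
    obtain rfl : γ = expo i j := (eq_expo_iff _ _ _).mpr (by omega)
    simp only [coeff_expo_X_mul_binomialForm_pow, coeff_expo_eq_eval (compatible_op _)]
    rw [Nat.cast_add, eval_bsPoly, Finset.sum_mul]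
    exact Finset.sum_congr rfl fun k _ => by ring
  · rw [coeff_X_mul_binomialForm_pow, if_neg hγ, mul_zero]
    refine (Finset.sum_eq_zero fun k _ => ?_).symm
    rw [coeff_eq_zero_of_compatible (compatible_op k) hγ, mul_zero]

theorem mul_X_add_C_dvd {p b : Polynomial ℚ} (hp : p ∣ b) {c : ℚ} (hb : b.IsRoot (-c))
    (hc : p.eval (-c) ≠ 0) : p * (Polynomial.X + Polynomial.C c) ∣ b := by
  obtain ⟨q, rfl⟩ := hp
  refine mul_dvd_mul_left p ?_
  have hq : q.IsRoot (-c) := (mul_eq_zero.mp (by simpa using hb)).resolve_left hc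
  simpa using Polynomial.dvd_iff_isRoot.mpr hq

end BernsteinSato

open BernsteinSato

theorem bernsteinSato_stmt_10 :
    ∀ b : Polynomial ℚ,
      SatisfiesBS (X 2 * (X 0) ^ 2 + X 3 * (X 1) ^ 3 : MvPolynomial (Fin 4) ℚ)
          (X 1) b ↔
        (Polynomial.X + Polynomial.C (1 : ℚ)) *
            (Polynomial.X + Polynomial.C (7 / 6 : ℚ)) *
            (Polynomial.X + Polynomial.C (3 / 2 : ℚ)) *
            (Polynomial.X + Polynomial.C (5 / 3 : ℚ)) *
            (Polynomial.X + Polynomial.C (11 / 6 : ℚ)) *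
            (Polynomial.X + Polynomial.C (2 : ℚ)) *
            (Polynomial.X + Polynomial.C (7 / 3 : ℚ)) ∣ b := by
  intro b
  refine ⟨fun h => ?_, ?_⟩
  swap
  · rintro ⟨c, rfl⟩
    exact satisfiesBS_bsPoly.mul_right c
  have root (i j : ℚ) (hv : IsCommonZero ![i, j]) {c : ℚ} (hc : i + j = -c) : b.IsRoot (-c) :=
    hc ▸ SatisfiesBS.isRoot h hv
  have r₁ := root 0 (-1) (by simp [IsCommonZero]) (c := 1) (by norm_num)
  have r₂ := root (-2 / 3) (-1 / 2) (by simp [IsCommonZero]) (c := 7 / 6) (by norm_num)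
  have r₃ := root (-1) (-1 / 2) (by simp [IsCommonZero]) (c := 3 / 2) (by norm_num)
  have r₄ := root (-2 / 3) (-1) (by simp [IsCommonZero]) (c := 5 / 3) (by norm_num)
  have r₅ := root (-4 / 3) (-1 / 2) (by simp [IsCommonZero]) (c := 11 / 6) (by norm_num)
  have r₆ := root (-1) (-1) (by simp [IsCommonZero]) (c := 2) (by norm_num)
  have r₇ := root (-4 / 3) (-1) (by simp [IsCommonZero]) (c := 7 / 3) (by norm_num)
  have d₁ : Polynomial.X + Polynomial.C (1 : ℚ) ∣ b := by
    simpa using Polynomial.dvd_iff_isRoot.mpr r₁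
  refine mul_X_add_C_dvd (mul_X_add_C_dvd (mul_X_add_C_dvd (mul_X_add_C_dvd (mul_X_add_C_dvd
    (mul_X_add_C_dvd d₁ r₂ ?_) r₃ ?_) r₄ ?_) r₅ ?_) r₆ ?_) r₇ ?_ <;> norm_num
end

section
/- Let f = (x+y)² − (x−y)⁵ in ℚ[x,y] (a degenerate polynomial). For every b ∈ ℚ[s], b satisfies the Bernstein–Sato functional equation for the pair (f, 1) if and only if (s + 7/10)(s + 9/10)(s + 1)(s + 11/10)(s + 13/10) divides b in ℚ[s]; that is, b_f(s) = (s + 7/10)(s + 9/10)(s + 1)(s + 11/10)(s + 13/10). -/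
open MvPolynomial Polynomial

namespace BernsteinSato

lemma pderiv_comm {R σ : Type*} [CommSemiring R] (i j : σ) (q : MvPolynomial σ R) :
    pderiv i (pderiv j q) = pderiv j (pderiv i q) := by
  classical
  rcases eq_or_ne i j with rfl | h
  · rfl
  ext d
  simp only [MvPolynomial.coeff_pderiv, Finsupp.add_apply, Finsupp.single_apply, h, h.symm,
    if_false, add_zero, add_right_comm d]
  ring

lemma pdIter_fin_two (α : Fin 2 → ℕ) (q : MvPolynomial (Fin 2) ℚ) :
    pdIter α q = (pderiv 1)^[α 1] ((pderiv 0)^[α 0] q) := by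
  have hperm : (Finset.univ : Finset (Fin 2)).toList.Perm [0, 1] := by
    rw [← Multiset.coe_eq_coe, Finset.coe_toList]
    rfl
  unfold pdIter
  rw [hperm.foldl_eq']
  · rfl
  · intro i _ j _ z
    exact Function.Commute.iterate_iterate (fun q => pderiv_comm j i q) _ _ z

lemma pdIter_add_single (α : Fin 2 → ℕ) (i : Fin 2) (q : MvPolynomial (Fin 2) ℚ) :
    pdIter (α + Pi.single i 1) q = pderiv i (pdIter α q) := by
  simp only [pdIter_fin_two]
  fin_cases i
  · have hcomm := (Function.Commute.iterate_left
      (fun q : MvPolynomial (Fin 2) ℚ => pderiv_comm 1 0 q) (α 1)) ((pderiv 0)^[α 0] q)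
    simpa [Function.iterate_succ_apply'] using hcomm
  · simp [Function.iterate_succ_apply']

/-- The sequence `h` is obtained from `F` by letting a differential operator `P(s)`, with
coefficients polynomial in `s`, act on each `F m` with `s = m`. -/
def InOrbit (F h : ℕ → MvPolynomial (Fin 2) ℚ) : Prop :=
  ∃ P : (Fin 2 → ℕ) →₀ Polynomial (MvPolynomial (Fin 2) ℚ),
    ∀ m : ℕ, h m =
      P.sum fun α q => Polynomial.eval (m : MvPolynomial (Fin 2) ℚ) q * pdIter α (F m)

namespace InOrbit

variable {F g h : ℕ → MvPolynomial (Fin 2) ℚ}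

lemma self (F : ℕ → MvPolynomial (Fin 2) ℚ) : InOrbit F F :=
  ⟨Finsupp.single 0 1, fun m => by simp [pdIter_fin_two]⟩

lemma add (hg : InOrbit F g) (hh : InOrbit F h) : InOrbit F (g + h) := by
  obtain ⟨P, hP⟩ := hg
  obtain ⟨Q, hQ⟩ := hh
  refine ⟨P + Q, fun m => ?_⟩
  rw [Finsupp.sum_add_index' (by simp) (by simp [add_mul]), Pi.add_apply, hP, hQ]

lemma mul (hg : InOrbit F g) (c : Polynomial (MvPolynomial (Fin 2) ℚ)) :
    InOrbit F fun m => Polynomial.eval (m : MvPolynomial (Fin 2) ℚ) c * g m := by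
  obtain ⟨P, hP⟩ := hg
  refine ⟨P.mapRange (c * ·) (mul_zero c), fun m => ?_⟩
  beta_reduce
  rw [Finsupp.sum_mapRange_index (by simp), hP, Finsupp.mul_sum]
  simp [mul_assoc]

lemma pderiv (hg : InOrbit F g) (i : Fin 2) : InOrbit F fun m => MvPolynomial.pderiv i (g m) := by
  obtain ⟨P, hP⟩ := hg
  obtain rfl : g = _ := funext hP
  clear hP
  induction P using Finsupp.induction_linear with
  | zero => exact ⟨0, by simp⟩
  | add P Q hP hQ =>
    convert hP.add hQ using 2 with m
    rw [Pi.add_apply]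
    beta_reduce
    rw [Finsupp.sum_add_index' (by simp) (by simp [add_mul]), map_add]
  | single α q =>
    have hderiv : ∃ q' : Polynomial (MvPolynomial (Fin 2) ℚ), ∀ m : ℕ,
        MvPolynomial.pderiv i (Polynomial.eval (m : MvPolynomial (Fin 2) ℚ) q) =
          Polynomial.eval (m : MvPolynomial (Fin 2) ℚ) q' := by
      induction q using Polynomial.induction_on' with
      | add q r hq hr =>
        obtain ⟨q', hq⟩ := hq
        obtain ⟨r', hr⟩ := hr
        exact ⟨q' + r', fun m => by simp [hq, hr]⟩
      | monomial n a =>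
        refine ⟨Polynomial.monomial n (MvPolynomial.pderiv i a), fun m => ?_⟩
        simp [Derivation.leibniz_pow, mul_comm]
    obtain ⟨q', hq'⟩ := hderiv
    refine ⟨Finsupp.single α q' + Finsupp.single (α + Pi.single i 1) q, fun m => ?_⟩
    rw [Finsupp.sum_add_index' (by simp) (by simp [add_mul])]
    simp only [Finsupp.sum_single_index, Polynomial.eval_zero, zero_mul, pdIter_add_single,
      MvPolynomial.pderiv_mul, hq']

lemma satisfiesBS {f : MvPolynomial (Fin 2) ℚ} {b : Polynomial ℚ}
    (hb : InOrbit (fun m => f ^ (m + 1))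
      fun m => MvPolynomial.C (Polynomial.eval (m : ℚ) b) * f ^ m) :
    SatisfiesBS f 1 b := by
  obtain ⟨P, hP⟩ := hb
  exact ⟨P.support, P, fun m => by simpa [Finsupp.sum] using hP m⟩

end InOrbit

/-- The polynomial `(x + y)² - (x - y)⁵`. -/
noncomputable def cuspPoly (R : Type*) [CommRing R] : MvPolynomial (Fin 2) R :=
  (MvPolynomial.X 0 + MvPolynomial.X 1) ^ 2 - (MvPolynomial.X 0 - MvPolynomial.X 1) ^ 5

lemma pderiv_cuspPoly_zero (R : Type*) [CommRing R] : MvPolynomial.pderiv 0 (cuspPoly R) =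
    2 * (MvPolynomial.X 0 + MvPolynomial.X 1) -
      5 * (MvPolynomial.X 0 - MvPolynomial.X 1) ^ 4 := by
  simp [cuspPoly, mul_add]

lemma pderiv_cuspPoly_one (R : Type*) [CommRing R] : MvPolynomial.pderiv 1 (cuspPoly R) =
    2 * (MvPolynomial.X 0 + MvPolynomial.X 1) +
      5 * (MvPolynomial.X 0 - MvPolynomial.X 1) ^ 4 := by
  simp [cuspPoly, mul_add]

lemma inOrbit_step {F : ℕ → MvPolynomial (Fin 2) ℚ} (c : Polynomial ℚ) (j : ℕ)
    (hu : InOrbit F fun m => MvPolynomial.C (Polynomial.eval (m : ℚ) c) *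
      (MvPolynomial.X 0 + MvPolynomial.X 1) * cuspPoly ℚ ^ m)
    (hv : InOrbit F fun m => MvPolynomial.C (Polynomial.eval (m : ℚ) c) *
      (MvPolynomial.X 0 - MvPolynomial.X 1) ^ (j + 1) * cuspPoly ℚ ^ m) :
    InOrbit F fun m => MvPolynomial.C (Polynomial.eval (m : ℚ)
        (c * (Polynomial.X + Polynomial.C ((7 + 2 * j : ℚ) / 10)))) *
      (MvPolynomial.X 0 - MvPolynomial.X 1) ^ j * cuspPoly ℚ ^ m := by
  have hu' := hu.mul (Polynomial.C ((MvPolynomial.X 0 - MvPolynomial.X 1) ^ j))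
  have key := ((((hu'.pderiv 0).add (hu'.pderiv 1)).mul
      (Polynomial.C (MvPolynomial.C (1 / 4 : ℚ)))).add
    (((hv.pderiv 0).mul (Polynomial.C (MvPolynomial.C (1 / 10 : ℚ)))).add
      ((hv.pderiv 1).mul (Polynomial.C (MvPolynomial.C (-1 / 10 : ℚ))))))
  convert key using 2 with m
  have h1 : MvPolynomial.C (σ := Fin 2) (1 / 4 : ℚ) = 5 * MvPolynomial.C (1 / 20) := by
    rw [← map_ofNat MvPolynomial.C 5, ← map_mul]; norm_num
  have h2 : MvPolynomial.C (σ := Fin 2) (1 / 10 : ℚ) = 2 * MvPolynomial.C (1 / 20) := by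
    rw [← map_ofNat MvPolynomial.C 2, ← map_mul]; norm_num
  have h3 : MvPolynomial.C (σ := Fin 2) (-1 / 10 : ℚ) = -2 * MvPolynomial.C (1 / 20) := by
    rw [← map_ofNat MvPolynomial.C 2, ← map_neg, ← map_mul]; norm_num
  have h4 : MvPolynomial.C (σ := Fin 2) ((7 + 2 * j : ℚ) / 10) =
      (7 + 2 * (j : MvPolynomial (Fin 2) ℚ)) * (2 * MvPolynomial.C (1 / 20)) := by
    rw [← map_ofNat MvPolynomial.C 2, ← map_ofNat MvPolynomial.C 7, ← map_natCast MvPolynomial.C j,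
      ← map_mul, ← map_mul, ← map_add, ← map_mul]
    congr 1; ring
  have h5 : 20 * MvPolynomial.C (σ := Fin 2) (1 / 20 : ℚ) = 1 := by
    rw [← map_ofNat MvPolynomial.C 20, ← map_mul]; norm_num
  simp only [Pi.add_apply, Polynomial.eval_C, Polynomial.eval_mul, Polynomial.eval_add,
    Polynomial.eval_X, map_mul, map_add, h1, h2, h3, h4, map_natCast]
  generalize MvPolynomial.C (σ := Fin 2) (1 / 20 : ℚ) = t at *
  rcases m with _ | m
  · simp
    ring
  · simp [pderiv_cuspPoly_zero, pderiv_cuspPoly_one]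
    generalize MvPolynomial.C (σ := Fin 2) (Polynomial.eval ((m : ℚ) + 1) c) = d
    have hf : cuspPoly ℚ ^ (m + 1) = cuspPoly ℚ ^ m *
      ((MvPolynomial.X 0 + MvPolynomial.X 1) ^ 2 - (MvPolynomial.X 0 - MvPolynomial.X 1) ^ 5) :=
      pow_succ _ _
    simp only [hf]
    linear_combination (-d * (m + 1) * (MvPolynomial.X 0 - MvPolynomial.X 1) ^ j *
      cuspPoly ℚ ^ m * ((MvPolynomial.X 0 + MvPolynomial.X 1) ^ 2 -
        (MvPolynomial.X 0 - MvPolynomial.X 1) ^ 5)) * h5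

lemma eval_natCast_map_C {σ R : Type*} [CommSemiring R] (m : ℕ) (d : Polynomial R) :
    Polynomial.eval (m : MvPolynomial σ R) (d.map MvPolynomial.C) =
      MvPolynomial.C (Polynomial.eval (m : R) d) := by
  rw [← map_natCast (MvPolynomial.C (σ := σ)) m, Polynomial.eval_map, Polynomial.eval₂_at_apply]

lemma satisfiesBS_cuspPoly : SatisfiesBS (cuspPoly ℚ) 1
    ((Polynomial.X + Polynomial.C (7 / 10 : ℚ)) * (Polynomial.X + Polynomial.C (9 / 10 : ℚ)) *
      (Polynomial.X + Polynomial.C (1 : ℚ)) * (Polynomial.X + Polynomial.C (11 / 10 : ℚ)) *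
      (Polynomial.X + Polynomial.C (13 / 10 : ℚ))) := by
  have hF := InOrbit.self fun m => cuspPoly ℚ ^ (m + 1)
  have hu : InOrbit (fun m => cuspPoly ℚ ^ (m + 1)) fun m =>
      MvPolynomial.C (Polynomial.eval (m : ℚ) (Polynomial.X + Polynomial.C 1)) *
        (MvPolynomial.X 0 + MvPolynomial.X 1) * cuspPoly ℚ ^ m := by
    convert ((hF.pderiv 0).add (hF.pderiv 1)).mul (Polynomial.C (MvPolynomial.C (1 / 4 : ℚ)))
      using 2 with m
    have h : 4 * MvPolynomial.C (σ := Fin 2) (1 / 4 : ℚ) = 1 := by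
      rw [← map_ofNat MvPolynomial.C 4, ← map_mul]; norm_num
    simp [pderiv_cuspPoly_zero, pderiv_cuspPoly_one, -one_div]
    linear_combination (-((m : MvPolynomial (Fin 2) ℚ) + 1) *
      (MvPolynomial.X 0 + MvPolynomial.X 1) * cuspPoly ℚ ^ m) * h
  have hv : InOrbit (fun m => cuspPoly ℚ ^ (m + 1)) fun m =>
      MvPolynomial.C (Polynomial.eval (m : ℚ) (Polynomial.X + Polynomial.C 1)) *
        (MvPolynomial.X 0 - MvPolynomial.X 1) ^ (3 + 1) * cuspPoly ℚ ^ m := by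
    convert ((hF.pderiv 1).add ((hF.pderiv 0).mul (-1))).mul
      (Polynomial.C (MvPolynomial.C (1 / 10 : ℚ))) using 2 with m
    have h : 10 * MvPolynomial.C (σ := Fin 2) (1 / 10 : ℚ) = 1 := by
      rw [← map_ofNat MvPolynomial.C 10, ← map_mul]; norm_num
    simp [pderiv_cuspPoly_zero, pderiv_cuspPoly_one, -one_div]
    linear_combination (-((m : MvPolynomial (Fin 2) ℚ) + 1) *
      (MvPolynomial.X 0 - MvPolynomial.X 1) ^ 4 * cuspPoly ℚ ^ m) * h
  have hmul : ∀ {c : Polynomial ℚ} (d : Polynomial ℚ) {g : MvPolynomial (Fin 2) ℚ},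
      InOrbit (fun m => cuspPoly ℚ ^ (m + 1))
        (fun m => MvPolynomial.C (Polynomial.eval (m : ℚ) c) * g * cuspPoly ℚ ^ m) →
      InOrbit (fun m => cuspPoly ℚ ^ (m + 1))
        (fun m => MvPolynomial.C (Polynomial.eval (m : ℚ) (c * d)) * g * cuspPoly ℚ ^ m) := by
    intro c d g h
    convert h.mul (d.map MvPolynomial.C) using 2 with m
    rw [eval_natCast_map_C, Polynomial.eval_mul, map_mul]
    ring
  have h3 := inOrbit_step _ 3 hu hv
  have h2 := inOrbit_step _ 2 (hmul _ hu) h3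
  have h1 := inOrbit_step _ 1 (hmul _ (hmul _ hu)) h2
  have h0 := inOrbit_step _ 0 (hmul _ (hmul _ (hmul _ hu))) h1
  refine InOrbit.satisfiesBS ?_
  convert h0 using 3 with m
  rw [pow_zero, mul_one]
  norm_num
  ring_nf

lemma SatisfiesBS.of_dvd {f g : MvPolynomial (Fin 2) ℚ} {b c : Polynomial ℚ}
    (hb : SatisfiesBS f g b) (hc : b ∣ c) : SatisfiesBS f g c := by
  obtain ⟨d, rfl⟩ := hc
  obtain ⟨A, p, h⟩ := hb
  refine ⟨A, fun α => d.map MvPolynomial.C * p α, fun m => ?_⟩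
  simp only [Polynomial.eval_mul, eval_natCast_map_C, mul_assoc, ← Finset.mul_sum, ← h m, map_mul]
  ring


/-- The substitution turning `x + y` and `x - y` into the coordinates, when `2` is invertible. -/
noncomputable def rotate (K : Type*) [Field K] :
    MvPolynomial (Fin 2) K →ₐ[K] MvPolynomial (Fin 2) K :=
  MvPolynomial.aeval ![MvPolynomial.C (2⁻¹ : K) * (MvPolynomial.X 0 + MvPolynomial.X 1),
    MvPolynomial.C (2⁻¹ : K) * (MvPolynomial.X 0 - MvPolynomial.X 1)]

lemma two_mul_C_inv_two {K : Type*} [Field K] (h2 : (2 : K) ≠ 0) :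
    2 * MvPolynomial.C (σ := Fin 2) (2⁻¹ : K) = 1 := by
  rw [← map_ofNat MvPolynomial.C 2, ← map_mul, mul_inv_cancel₀ h2, map_one]

lemma rotate_X_add_X {K : Type*} [Field K] (h2 : (2 : K) ≠ 0) :
    rotate K (MvPolynomial.X 0 + MvPolynomial.X 1) = MvPolynomial.X 0 := by
  simp only [rotate, map_add, MvPolynomial.aeval_X, Matrix.cons_val_zero, Matrix.cons_val_one]
  linear_combination MvPolynomial.X 0 * two_mul_C_inv_two h2

lemma rotate_X_sub_X {K : Type*} [Field K] (h2 : (2 : K) ≠ 0) :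
    rotate K (MvPolynomial.X 0 - MvPolynomial.X 1) = MvPolynomial.X 1 := by
  simp only [rotate, map_sub, MvPolynomial.aeval_X, Matrix.cons_val_zero, Matrix.cons_val_one]
  linear_combination MvPolynomial.X 1 * two_mul_C_inv_two h2

lemma rotate_cuspPoly_pow {K : Type*} [Field K] (h2 : (2 : K) ≠ 0) (n : ℕ) :
    rotate K (cuspPoly K ^ n) = ∑ i ∈ Finset.range (n + 1),
      MvPolynomial.monomial (Finsupp.single 0 (2 * i) + Finsupp.single 1 (5 * (n - i)))
        ((-1) ^ (n - i) * (n.choose i : K)) := by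
  rw [map_pow, cuspPoly, map_sub, map_pow, map_pow, rotate_X_add_X h2, rotate_X_sub_X h2,
    sub_eq_add_neg, add_pow]
  refine Finset.sum_congr rfl fun i _ => ?_
  rw [neg_pow, ← pow_mul, ← pow_mul, ← mul_one ((-1) ^ (n - i) * (n.choose i : K)),
    ← MvPolynomial.C_mul_monomial, ← one_mul (1 : K), ← MvPolynomial.monomial_mul,
    ← MvPolynomial.X_pow_eq_monomial, ← MvPolynomial.X_pow_eq_monomial]
  simp only [map_mul, map_pow, map_neg, map_one, map_natCast]
  ring

lemma rotate_pderiv {K : Type*} [Field K] (h2 : (2 : K) ≠ 0) (q : MvPolynomial (Fin 2) K) :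
    rotate K (MvPolynomial.pderiv 0 q) =
        MvPolynomial.pderiv 0 (rotate K q) + MvPolynomial.pderiv 1 (rotate K q) ∧
      rotate K (MvPolynomial.pderiv 1 q) =
        MvPolynomial.pderiv 0 (rotate K q) - MvPolynomial.pderiv 1 (rotate K q) := by
  induction q using MvPolynomial.induction_on with
  | C a => simp [rotate]
  | add q r hq hr =>
    constructor
    · simp only [map_add, hq.1, hr.1]; ring
    · simp only [map_add, hq.2, hr.2]; ring
  | mul_X q i hq =>
    have h0 : rotate K (MvPolynomial.X 0) =
        MvPolynomial.C (2⁻¹ : K) * (MvPolynomial.X 0 + MvPolynomial.X 1) := by simp [rotate]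
    have h1 : rotate K (MvPolynomial.X 1) =
        MvPolynomial.C (2⁻¹ : K) * (MvPolynomial.X 0 - MvPolynomial.X 1) := by simp [rotate]
    have h := two_mul_C_inv_two h2
    generalize (2⁻¹ : K) = t at *
    constructor <;> fin_cases i <;> simp [hq.1, hq.2, h0, h1]
    · linear_combination -rotate K q * h
    · ring
    · ring
    · linear_combination -rotate K q * h

/-- The coefficient of `u ^ e 0 * v ^ e 1`, where `u = x + y` and `v = x - y`. -/
noncomputable def residue (K : Type*) [Field K] (e : Fin 2 →₀ ℕ) (q : MvPolynomial (Fin 2) K) : K :=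
  MvPolynomial.coeff e (rotate K q)

lemma residue_pderiv {K : Type*} [Field K] (h2 : (2 : K) ≠ 0) {e : Fin 2 →₀ ℕ}
    (he : ∀ i, ((e i + 1 : ℕ) : K) = 0) (i : Fin 2) (q : MvPolynomial (Fin 2) K) :
    residue K e (MvPolynomial.pderiv i q) = 0 := by
  have h (j : Fin 2) (r : MvPolynomial (Fin 2) K) :
      MvPolynomial.coeff e (MvPolynomial.pderiv j r) = 0 := by
    rw [MvPolynomial.coeff_pderiv, ← Nat.cast_add_one, he, mul_zero]
  fin_cases i
  · simp [residue, (rotate_pderiv h2 q).1, h]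
  · simp [residue, (rotate_pderiv h2 q).2, h]

lemma residue_mul_iterate_pderiv {K : Type*} [Field K] (h2 : (2 : K) ≠ 0) {e : Fin 2 →₀ ℕ}
    (he : ∀ i, ((e i + 1 : ℕ) : K) = 0) (i : Fin 2) (n : ℕ) {q : MvPolynomial (Fin 2) K}
    (hq : ∀ c, residue K e (c * q) = 0) (c : MvPolynomial (Fin 2) K) :
    residue K e (c * (MvPolynomial.pderiv i)^[n] q) = 0 := by
  induction n generalizing c with
  | zero => exact hq c
  | succ n ih =>
    have h := residue_pderiv h2 he i (c * (MvPolynomial.pderiv i)^[n] q)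
    rw [MvPolynomial.pderiv_mul, residue, map_add, MvPolynomial.coeff_add] at h
    rw [Function.iterate_succ_apply']
    have ih' := ih (MvPolynomial.pderiv i c)
    rw [residue] at ih' ⊢
    rwa [ih', zero_add] at h

lemma residue_mul_cuspPoly_pow {K : Type*} [Field K] (h2 : (2 : K) ≠ 0) {e : Fin 2 →₀ ℕ} {n : ℕ}
    (hn : ∀ i ≤ n, (n.choose i : K) = 0 ∨ e 0 < 2 * i ∨ e 1 < 5 * (n - i))
    (c : MvPolynomial (Fin 2) K) : residue K e (c * cuspPoly K ^ n) = 0 := by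
  rw [residue, map_mul, rotate_cuspPoly_pow h2, Finset.mul_sum, MvPolynomial.coeff_sum]
  refine Finset.sum_eq_zero fun i hi => ?_
  rw [MvPolynomial.coeff_mul_monomial']
  split_ifs with hle
  · rcases hn i (by simpa [Nat.lt_succ_iff] using hi) with h | h | h
    · simp [h]
    · have := hle 0
      simp at this
      omega
    · have := hle 1
      simp at this
      omega
  · rfl

lemma residue_monomial_mul_cuspPoly_pow {K : Type*} [Field K] (h2 : (2 : K) ≠ 0)
    {e : Fin 2 →₀ ℕ} {m i a c : ℕ} (hi : i ≤ m) (h0 : a + 2 * i = e 0)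
    (h1 : c + 5 * (m - i) = e 1) :
    residue K e ((MvPolynomial.X 0 + MvPolynomial.X 1) ^ a *
      (MvPolynomial.X 0 - MvPolynomial.X 1) ^ c * cuspPoly K ^ m) =
        (-1) ^ (m - i) * (m.choose i : K) := by
  rw [residue, map_mul, map_mul, map_pow, map_pow, rotate_X_add_X h2, rotate_X_sub_X h2,
    rotate_cuspPoly_pow h2, MvPolynomial.X_pow_eq_monomial, MvPolynomial.X_pow_eq_monomial,
    MvPolynomial.monomial_mul, Finset.mul_sum, MvPolynomial.coeff_sum]
  simp only [MvPolynomial.monomial_mul, MvPolynomial.coeff_monomial, one_mul]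
  rw [Finset.sum_eq_single_of_mem i (by simpa [Nat.lt_succ_iff] using hi)]
  · rw [if_pos]
    ext j
    fin_cases j <;> simp [h0, h1]
  · intro j _ hj
    rw [if_neg]
    intro h
    have := DFunLike.congr_fun h 0
    simp at this
    omega

lemma eq_zero_of_operator {K : Type*} [Field K] (h2 : (2 : K) ≠ 0) {e : Fin 2 →₀ ℕ}
    (he : ∀ i, ((e i + 1 : ℕ) : K) = 0) {m i a c : ℕ}
    (hn : ∀ i ≤ m + 1,
      ((m + 1).choose i : K) = 0 ∨ e 0 < 2 * i ∨ e 1 < 5 * (m + 1 - i))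
    (hi : i ≤ m) (h0 : a + 2 * i = e 0) (h1 : c + 5 * (m - i) = e 1)
    (hchoose : (m.choose i : K) ≠ 0) {β : K} {A : Finset (Fin 2 → ℕ)}
    {q : (Fin 2 → ℕ) → MvPolynomial (Fin 2) K}
    (h : MvPolynomial.C β * cuspPoly K ^ m = ∑ α ∈ A, q α *
      (MvPolynomial.pderiv 1)^[α 1] ((MvPolynomial.pderiv 0)^[α 0] (cuspPoly K ^ (m + 1)))) :
    β = 0 := by
  set g : MvPolynomial (Fin 2) K := (MvPolynomial.X 0 + MvPolynomial.X 1) ^ a *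
      (MvPolynomial.X 0 - MvPolynomial.X 1) ^ c
  have hL : residue K e (g * (MvPolynomial.C β * cuspPoly K ^ m)) = 0 := by
    rw [h, Finset.mul_sum, residue, map_sum, MvPolynomial.coeff_sum]
    refine Finset.sum_eq_zero fun α _ => ?_
    rw [← mul_assoc]
    exact residue_mul_iterate_pderiv h2 he 1 _
      (residue_mul_iterate_pderiv h2 he 0 _ (residue_mul_cuspPoly_pow h2 hn)) _
  rw [mul_left_comm, residue, ← MvPolynomial.algebraMap_eq, ← Algebra.smul_def, map_smul,
    MvPolynomial.coeff_smul, ← residue, residue_monomial_mul_cuspPoly_pow h2 hi h0 h1] at hL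
  simpa [hchoose] using hL


section ClearDenominators

variable {R S : Type*} [CommRing R] [CommRing S] (φ : R →+* S)

/-- Every element of `S` has a nonzero integer multiple in the range of `φ`. -/
def ClearsDenominators : Prop :=
  ∀ a : S, ∃ D : ℕ, D ≠ 0 ∧ ∃ a' : R, (D : S) * a = φ a'

variable {φ}

lemma clearsDenominators_intCast : ClearsDenominators (Int.castRingHom ℚ) := fun a =>
  ⟨a.den, a.den_nz, a.num, by simp⟩

lemma ClearsDenominators.polynomial (h : ClearsDenominators φ) :
    ClearsDenominators (Polynomial.mapRingHom φ) := by
  intro q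
  induction q using Polynomial.induction_on' with
  | add q r hq hr =>
    obtain ⟨D, hD, q', hq⟩ := hq
    obtain ⟨E, hE, r', hr⟩ := hr
    refine ⟨D * E, mul_ne_zero hD hE, E * q' + D * r', ?_⟩
    simp only [map_add, map_mul, map_natCast, ← hq, ← hr, Nat.cast_mul]
    ring
  | monomial n a =>
    obtain ⟨D, hD, a', ha⟩ := h a
    refine ⟨D, hD, Polynomial.monomial n a', ?_⟩
    rw [← Polynomial.C_eq_natCast, Polynomial.C_mul_monomial, ha]
    simp

lemma ClearsDenominators.mvPolynomial (h : ClearsDenominators φ) (σ : Type*) :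
    ClearsDenominators (MvPolynomial.map (σ := σ) φ) := by
  intro q
  induction q using MvPolynomial.induction_on' with
  | add q r hq hr =>
    obtain ⟨D, hD, q', hq⟩ := hq
    obtain ⟨E, hE, r', hr⟩ := hr
    refine ⟨D * E, mul_ne_zero hD hE, E * q' + D * r', ?_⟩
    simp only [map_add, map_mul, map_natCast, ← hq, ← hr, Nat.cast_mul]
    ring
  | monomial n a =>
    obtain ⟨D, hD, a', ha⟩ := h a
    refine ⟨D, hD, MvPolynomial.monomial n a', ?_⟩
    rw [← map_natCast (MvPolynomial.C (σ := σ)) D, MvPolynomial.C_mul_monomial, ha]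
    simp

lemma ClearsDenominators.exists_common (h : ClearsDenominators φ) {ι : Type*} (A : Finset ι)
    (q : ι → S) :
    ∃ D : ℕ, D ≠ 0 ∧ ∃ q' : ι → R, ∀ i ∈ A, (D : S) * q i = φ (q' i) := by
  classical
  choose D hD q' hq' using fun i => h (q i)
  refine ⟨∏ i ∈ A, D i, Finset.prod_ne_zero_iff.2 fun i _ => hD i,
    fun i => ((∏ j ∈ A.erase i, D j : ℕ) : R) * q' i, fun i hi => ?_⟩
  rw [← Finset.mul_prod_erase A D hi, map_mul, map_natCast, ← hq', Nat.cast_mul]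
  ring

end ClearDenominators

lemma map_cuspPoly {R S : Type*} [CommRing R] [CommRing S] (φ : R →+* S) :
    MvPolynomial.map φ (cuspPoly R) = cuspPoly S := by
  simp [cuspPoly]

lemma map_iterate_pderiv {R S σ : Type*} [CommRing R] [CommRing S] (φ : R →+* S) (i : σ) (n : ℕ)
    (q : MvPolynomial σ R) :
    MvPolynomial.map φ ((MvPolynomial.pderiv i)^[n] q) =
      (MvPolynomial.pderiv i)^[n] (MvPolynomial.map φ q) :=
  Function.Semiconj.iterate_right (f := MvPolynomial.map φ)
    (fun _ => MvPolynomial.pderiv_map.symm) n q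

lemma map_eval_natCast {R S : Type*} [CommRing R] [CommRing S] (φ : R →+* S)
    (q : Polynomial R) (m : ℕ) :
    φ (Polynomial.eval (m : R) q) = Polynomial.eval (m : S) (q.map φ) := by
  rw [Polynomial.eval_map, ← map_natCast φ m, Polynomial.eval₂_at_apply]

lemma exists_integral_relation {b : Polynomial ℚ} (hb : SatisfiesBS (cuspPoly ℚ) 1 b) :
    ∃ D : ℕ, D ≠ 0 ∧ ∃ b' : Polynomial ℤ, D * b = b'.map (Int.castRingHom ℚ) ∧
      ∃ (A : Finset (Fin 2 → ℕ)) (q : (Fin 2 → ℕ) → Polynomial (MvPolynomial (Fin 2) ℤ)),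
        ∀ m : ℕ, MvPolynomial.C (Polynomial.eval (m : ℤ) b') * cuspPoly ℤ ^ m =
          ∑ α ∈ A, Polynomial.eval (m : MvPolynomial (Fin 2) ℤ) (q α) *
            (MvPolynomial.pderiv 1)^[α 1]
              ((MvPolynomial.pderiv 0)^[α 0] (cuspPoly ℤ ^ (m + 1))) := by
  obtain ⟨A, p, h⟩ := hb
  obtain ⟨D, hD, b', hb'⟩ := clearsDenominators_intCast.polynomial b
  obtain ⟨E, hE, q, hq⟩ :=
    (clearsDenominators_intCast.mvPolynomial (Fin 2)).polynomial.exists_common A p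
  simp only [Polynomial.coe_mapRingHom] at hb' hq
  refine ⟨D * E, mul_ne_zero hD hE, E * b', ?_, A, fun α => D * q α, fun m => ?_⟩
  · rw [Polynomial.map_mul, ← hb', Polynomial.map_natCast]
    push_cast
    ring
  · apply MvPolynomial.map_injective (Int.castRingHom ℚ) Int.cast_injective
    rw [map_mul, MvPolynomial.map_C, map_eval_natCast, map_pow, map_cuspPoly, map_sum,
      Polynomial.map_mul, Polynomial.map_natCast, ← hb']
    have hm := h m
    simp only [mul_one, one_mul, pdIter_fin_two] at hm
    simp only [Polynomial.eval_mul, Polynomial.eval_natCast, map_mul, map_natCast]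
    rw [mul_assoc, mul_assoc, hm, Finset.mul_sum, Finset.mul_sum]
    refine Finset.sum_congr rfl fun α hα => ?_
    rw [map_eval_natCast, ← hq α hα, map_iterate_pderiv, map_iterate_pderiv, map_pow, map_cuspPoly]
    simp only [Polynomial.eval_mul, Polynomial.eval_natCast]
    ring

lemma eval_eq_zero_of_forall_prime {b : Polynomial ℤ} {r : ℕ}
    (h : ∀ N : ℕ, ∃ p > N, p.Prime ∧ ∃ m : ℕ, p ∣ 10 * m + r ∧
      ((Polynomial.eval (m : ℤ) b : ℤ) : ZMod p) = 0) :
    Polynomial.eval (-(r : ℚ) / 10) (b.map (Int.castRingHom ℚ)) = 0 := by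
  set M : ℤ := Polynomial.eval (-(r : ℤ)) (b.scaleRoots 10) with hM
  have hM0 : M = 0 := by
    obtain ⟨p, hpM, hp, m, hdvd, hm⟩ := h M.natAbs
    have hr : Int.castRingHom (ZMod p) (-(r : ℤ)) = Int.castRingHom (ZMod p) 10 * (m : ZMod p) := by
      have := (ZMod.natCast_eq_zero_iff _ _).2 hdvd
      push_cast at this
      simp only [map_neg, map_natCast, map_ofNat]
      linear_combination -this
    have hMp : Int.castRingHom (ZMod p) M = 0 := by
      rw [hM, ← Polynomial.eval₂_at_apply, hr, Polynomial.scaleRoots_eval₂_mul,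
        ← map_natCast (Int.castRingHom (ZMod p)) m, Polynomial.eval₂_at_apply]
      simp [hm]
    have := (ZMod.intCast_zmod_eq_zero_iff_dvd M p).1 hMp
    exact Int.eq_zero_of_dvd_of_natAbs_lt_natAbs this (by simpa using hpM)
  have hr : Int.castRingHom ℚ (-(r : ℤ)) = Int.castRingHom ℚ 10 * (-(r : ℚ) / 10) := by
    simp
    ring
  have hMq : Int.castRingHom ℚ M = 0 := by rw [hM0, map_zero]
  rw [hM, ← Polynomial.eval₂_at_apply, hr, Polynomial.scaleRoots_eval₂_mul] at hMq
  rw [Polynomial.eval_map]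
  simpa using hMq

lemma eval_eq_zero_of_residue {b : Polynomial ℚ} (hb : SatisfiesBS (cuspPoly ℚ) 1 b) {r : ℕ}
    (h : ∀ N : ℕ, ∃ p > N, p.Prime ∧ p ≠ 2 ∧ ∃ (m i a c : ℕ) (e : Fin 2 →₀ ℕ), p ∣ 10 * m + r ∧
      (∀ i, p ∣ e i + 1) ∧
      (∀ i ≤ m + 1, p ∣ (m + 1).choose i ∨ e 0 < 2 * i ∨ e 1 < 5 * (m + 1 - i)) ∧
      i ≤ m ∧ a + 2 * i = e 0 ∧ c + 5 * (m - i) = e 1 ∧ ¬ p ∣ m.choose i) :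
    Polynomial.eval (-(r : ℚ) / 10) b = 0 := by
  obtain ⟨D, hD, b', hb', A, q, hq⟩ := exists_integral_relation hb
  have hzero : Polynomial.eval (-(r : ℚ) / 10) (b'.map (Int.castRingHom ℚ)) = 0 := by
    refine eval_eq_zero_of_forall_prime fun N => ?_
    obtain ⟨p, hpN, hp, hp2, m, i, a, c, e, hdvd, he, hn, hi, h0, h1, hchoose⟩ := h N
    refine ⟨p, hpN, hp, m, hdvd, ?_⟩
    have := Fact.mk hp
    have h2 : (2 : ZMod p) ≠ 0 := by
      intro h2
      have := (ZMod.natCast_eq_zero_iff 2 p).1 (by exact_mod_cast h2)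
      exact hp2 ((Nat.prime_dvd_prime_iff_eq hp Nat.prime_two).1 this)
    have hrel := congrArg (MvPolynomial.map (Int.castRingHom (ZMod p))) (hq m)
    rw [map_mul, MvPolynomial.map_C, map_pow, map_cuspPoly, map_sum] at hrel
    simp only [map_mul, map_iterate_pderiv, map_pow, map_cuspPoly] at hrel
    refine eq_zero_of_operator h2 (fun i => (ZMod.natCast_eq_zero_iff _ _).2 (he i)) ?_ hi h0 h1
      (by rwa [Ne, ZMod.natCast_eq_zero_iff]) hrel
    simpa only [ZMod.natCast_eq_zero_iff] using hn
  rw [← hb', Polynomial.eval_mul, Polynomial.eval_natCast] at hzero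
  exact (mul_eq_zero.1 hzero).resolve_left (by exact_mod_cast hD)

lemma eval_neg_one_eq_zero {b : Polynomial ℚ} (hb : SatisfiesBS (cuspPoly ℚ) 1 b) :
    Polynomial.eval (-1) b = 0 := by
  have h := eval_eq_zero_of_residue hb (r := 10) ?_
  · norm_num at h
    exact h
  intro N
  obtain ⟨p, hpN, hp⟩ := Nat.exists_infinite_primes (N + 3)
  refine ⟨p, by omega, hp, by omega, p - 1, p - 1, 1, p - 1,
    Finsupp.single 0 (2 * p - 1) + Finsupp.single 1 (p - 1), ?_, ?_, ?_, le_rfl, ?_, ?_, ?_⟩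
  · exact ⟨10, by omega⟩
  · intro i
    fin_cases i
    · exact ⟨2, by simp; omega⟩
    · exact ⟨1, by simp; omega⟩
  · intro i hi
    rw [Nat.sub_add_cancel (by omega)] at hi ⊢
    rcases Nat.eq_zero_or_pos i with rfl | hi0
    · right; right; simp; omega
    · rcases hi.lt_or_eq with hlt | rfl
      · exact Or.inl (hp.dvd_choose_self hi0.ne' hlt)
      · right; left; simp; omega
  · simp; omega
  · simp
  · rw [Nat.choose_self]
    exact hp.one_lt.ne' ∘ Nat.dvd_one.1

lemma eval_eq_zero_of_lt_five {b : Polynomial ℚ} (hb : SatisfiesBS (cuspPoly ℚ) 1 b) {k : ℕ}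
    (hk : 0 < k) (hk5 : k < 5) : Polynomial.eval (-((5 + 2 * k : ℕ) : ℚ) / 10) b = 0 := by
  refine eval_eq_zero_of_residue hb fun N => ?_
  obtain ⟨p, hpN, hp, hmod⟩ := Nat.forall_exists_prime_gt_and_modEq (N + 10) (q := 5) (a := k)
    (by norm_num) ((Nat.coprime_of_lt_prime hk.ne' hk5 Nat.prime_five).symm)
  have hodd := hp.eq_two_or_odd
  unfold Nat.ModEq at hmod
  obtain ⟨m, hm⟩ : ∃ m, 10 * m + (5 + 2 * k) = 7 * p := ⟨(7 * p - (5 + 2 * k)) / 10, by omega⟩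
  refine ⟨p, by omega, hp, by omega, m, (p - 1) / 2, 0, k - 1,
    Finsupp.single 0 (p - 1) + Finsupp.single 1 (p - 1), ?_, ?_, ?_, by omega, ?_, ?_, ?_⟩
  · exact ⟨7, by omega⟩
  · intro i
    fin_cases i <;> exact ⟨1, by simp; omega⟩
  · intro i hi
    right
    simp
    omega
  · simp; omega
  · simp; omega
  · intro h
    have hfac := h.mul_right (((p - 1) / 2).factorial * (m - (p - 1) / 2).factorial)
    rw [← mul_assoc, Nat.choose_mul_factorial_mul_factorial (by omega), hp.dvd_factorial] at hfac
    omega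

lemma dvd_of_satisfiesBS {b : Polynomial ℚ} (hb : SatisfiesBS (cuspPoly ℚ) 1 b) :
    (Polynomial.X + Polynomial.C (7 / 10 : ℚ)) * (Polynomial.X + Polynomial.C (9 / 10 : ℚ)) *
      (Polynomial.X + Polynomial.C (1 : ℚ)) * (Polynomial.X + Polynomial.C (11 / 10 : ℚ)) *
      (Polynomial.X + Polynomial.C (13 / 10 : ℚ)) ∣ b := by
  have hroot {r : ℚ} (hr : Polynomial.eval (-r) b = 0) : Polynomial.X + Polynomial.C r ∣ b := by
    rw [← sub_neg_eq_add, ← Polynomial.C_neg, Polynomial.dvd_iff_isRoot]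
    exact hr
  have hcop {r t : ℚ} (h : r ≠ t) :
      IsCoprime (Polynomial.X + Polynomial.C r) (Polynomial.X + Polynomial.C t) := by
    rw [← sub_neg_eq_add, ← sub_neg_eq_add, ← Polynomial.C_neg, ← Polynomial.C_neg]
    exact Polynomial.isCoprime_X_sub_C_of_isUnit_sub
      (sub_ne_zero.2 (neg_injective.ne h)).isUnit
  have h1 := eval_eq_zero_of_lt_five hb (k := 1) (by norm_num) (by norm_num)
  have h2 := eval_eq_zero_of_lt_five hb (k := 2) (by norm_num) (by norm_num)
  have h3 := eval_eq_zero_of_lt_five hb (k := 3) (by norm_num) (by norm_num)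
  have h4 := eval_eq_zero_of_lt_five hb (k := 4) (by norm_num) (by norm_num)
  have h5 := eval_neg_one_eq_zero hb
  norm_num at h1 h2 h3 h4
  refine IsCoprime.mul_dvd ?_ (IsCoprime.mul_dvd ?_ (IsCoprime.mul_dvd ?_
    (IsCoprime.mul_dvd ?_ (hroot (by norm_num; exact h1)) (hroot (by norm_num; exact h2)))
    (hroot h5)) (hroot (by norm_num; exact h3))) (hroot (by norm_num; exact h4))
  all_goals
    try simp only [IsCoprime.mul_left_iff]
    repeat' apply And.intro
    all_goals exact hcop (by norm_num)

end BernsteinSato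

theorem bernsteinSato_stmt_11 :
    ∀ b : Polynomial ℚ,
      SatisfiesBS ((X 0 + X 1) ^ 2 - (X 0 - X 1) ^ 5 : MvPolynomial (Fin 2) ℚ)
          (1) b ↔
        (Polynomial.X + Polynomial.C (7 / 10 : ℚ)) *
            (Polynomial.X + Polynomial.C (9 / 10 : ℚ)) *
            (Polynomial.X + Polynomial.C (1 : ℚ)) *
            (Polynomial.X + Polynomial.C (11 / 10 : ℚ)) *
            (Polynomial.X + Polynomial.C (13 / 10 : ℚ)) ∣ b := by
  intro b
  rw [← BernsteinSato.cuspPoly]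
  exact ⟨BernsteinSato.dvd_of_satisfiesBS,
    BernsteinSato.SatisfiesBS.of_dvd BernsteinSato.satisfiesBS_cuspPoly⟩
end
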